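/- arXiv:2602.16319 — 3 statements merged into one kernel-verified Lean document; each statement's English description precedes it below -/
import Mathlib

section
/- Let g ≥ 4 be an even integer and let n > g be an integer such that neither (n is odd and g+3 ≤ n ≤ 2g−3) nor (n is even and g+2 ≤ n ≤ 4g−4) holds. Then an OF(n,g) exists. -/
/-- The weight of a word of length `m` over `ℤ_q` (represented as `Fin q`):
the number of nonzero coordinates. -/
def wordWeight {m q : ℕ} (x : Fin m → Fin q) : ℕ :=
  (Finset.univ.filter (fun i => (x i : ℕ) ≠ 0)).card

/-- The set `H(m)` of all words of length `m` and weight `2` over `ℤ_{g+1}`. -/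
def weightTwoWords (m g : ℕ) : Finset (Fin m → Fin (g + 1)) :=
  Finset.univ.filter (fun x => wordWeight x = 2)

/-- A partition of `H(m)` (words of length `m`, weight `2` over `ℤ_{g+1}`) into
`k` subsets, each of cardinality `s`, with pairwise Hamming distance at least
`3` inside each subset. -/
def HasDist3Partition (m g k s : ℕ) : Prop :=
  ∃ P : Fin k → Finset (Fin m → Fin (g + 1)),
    (∀ i j, i ≠ j → Disjoint (P i) (P j)) ∧
    (Finset.univ.biUnion P = weightTwoWords m g) ∧
    (∀ i, (P i).card = s) ∧
    (∀ i, ∀ x ∈ P i, ∀ y ∈ P i, x ≠ y → 3 ≤ hammingDist x y)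

/-- An `ODAR(m,g)`: a partition of `H(m)` into `g²` subsets, each of
cardinality `C(m,2)` and with pairwise Hamming distance at least 3. -/
def IsODAR (m g : ℕ) : Prop :=
  HasDist3Partition m g (g ^ 2) (m.choose 2)

/-- An `OF(m,g)`: a partition of `H(m)` into `g(m-1)` subsets, each of
cardinality `g·m/2` and with pairwise Hamming distance at least 3. -/
def IsOF (m g : ℕ) : Prop :=
  HasDist3Partition m g (g * (m - 1)) (g * m / 2)


namespace OFaux

/-- The word with entry `a+1` at `i` and `b+1` at `j`. -/
def word {n g : ℕ} (i j : Fin n) (a b : Fin g) : Fin n → Fin (g + 1) :=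
  fun k => if k = i then a.succ else if k = j then b.succ else 0

lemma word_left {n g : ℕ} (i j : Fin n) (a b : Fin g) : word i j a b i = a.succ := by
  simp [word]

lemma word_right {n g : ℕ} {i j : Fin n} (h : i ≠ j) (a b : Fin g) :
    word i j a b j = b.succ := by
  simp [word, h.symm]

lemma word_other {n g : ℕ} {i j k : Fin n} (h : k ≠ i) (h' : k ≠ j) (a b : Fin g) :
    word i j a b k = 0 := by
  simp [word, h, h']

lemma word_ne_zero {n g : ℕ} {i j k : Fin n} {a b : Fin g} (h : word i j a b k ≠ 0) :
    k = i ∨ k = j := by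
  by_contra! hc
  exact h (word_other hc.1 hc.2 a b)

lemma word_mem {n g : ℕ} {i j : Fin n} (h : i ≠ j) (a b : Fin g) :
    word i j a b ∈ weightTwoWords n g := by
  rw [weightTwoWords, Finset.mem_filter, wordWeight]
  refine ⟨Finset.mem_univ _, ?_⟩
  rw [← Finset.card_pair h]
  congr 1
  ext k
  simp only [Finset.mem_filter, Finset.mem_univ, true_and, Finset.mem_insert,
    Finset.mem_singleton]
  constructor
  · intro hk
    apply word_ne_zero (a := a) (b := b)
    intro h0
    exact hk (by rw [h0]; rfl)
  · rintro (rfl | rfl)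
    · rw [word_left]; simp
    · rw [word_right h]; simp

lemma exists_word {n g : ℕ} {x : Fin n → Fin (g + 1)} (hx : x ∈ weightTwoWords n g) :
    ∃ i j a b, i < j ∧ x = word i j a b := by
  rw [weightTwoWords, Finset.mem_filter, wordWeight] at hx
  replace hx := hx.2
  obtain ⟨i, j, hij, hs⟩ := Finset.card_eq_two.1 hx
  have key : ∀ i j : Fin n, i ≠ j →
      (Finset.univ.filter (fun i => (x i : ℕ) ≠ 0)) = {i, j} → ∃ a b, x = word i j a b := by
    intro i j hij hs
    have hm : ∀ k, (x k : ℕ) ≠ 0 ↔ k = i ∨ k = j := by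
      intro k
      have := congrArg (fun s => k ∈ s) hs
      simpa using this
    have hi : x i ≠ 0 := fun h => (hm i).2 (Or.inl rfl) (by rw [h]; rfl)
    have hj : x j ≠ 0 := fun h => (hm j).2 (Or.inr rfl) (by rw [h]; rfl)
    refine ⟨(x i).pred hi, (x j).pred hj, ?_⟩
    funext k
    by_cases h1 : k = i
    · subst h1; rw [word_left]; simp
    by_cases h2 : k = j
    · subst h2; rw [word_right hij]; simp
    rw [word_other h1 h2]
    by_contra hc
    have := (hm k).1 (fun h => hc (Fin.ext h))
    tauto
  rcases lt_or_gt_of_ne hij with h | h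
  · obtain ⟨a, b, h'⟩ := key i j hij hs
    exact ⟨i, j, a, b, h, h'⟩
  · obtain ⟨a, b, h'⟩ := key j i hij.symm (by rw [hs, Finset.pair_comm])
    exact ⟨j, i, a, b, h, h'⟩

lemma word_inj {n g : ℕ} {i j i' j' : Fin n} {a b a' b' : Fin g} (h : i < j) (h' : i' < j')
    (he : word i j a b = word i' j' a' b') : i = i' ∧ j = j' ∧ a = a' ∧ b = b' := by
  have e1 : i = i' ∨ i = j' := word_ne_zero (a := a') (b := b')
    (by rw [← he, word_left]; exact Fin.succ_ne_zero _)
  have e2 : j = i' ∨ j = j' := word_ne_zero (a := a') (b := b')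
    (by rw [← he, word_right h.ne]; exact Fin.succ_ne_zero _)
  have hi : i = i' := by
    rcases e1 with e | e
    · exact e
    · rcases e2 with e2 | e2
      · subst e e2; exact absurd h (not_lt.2 h'.le)
      · subst e e2; exact absurd h (lt_irrefl _)
  have hj : j = j' := by
    rcases e2 with e | e
    · subst hi e; exact absurd h (lt_irrefl _)
    · exact e
  subst hi hj
  refine ⟨rfl, rfl, ?_, ?_⟩
  · have := congrFun he i
    rw [word_left, word_left] at this
    exact Fin.succ_injective _ this
  · have := congrFun he j
    rw [word_right h.ne, word_right h.ne] at this
    exact Fin.succ_injective _ this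

lemma three_le {n g : ℕ} {x y : Fin n → Fin (g + 1)} (p q r : Fin n) (hpq : p ≠ q) (hpr : p ≠ r)
    (hqr : q ≠ r) (h1 : x p ≠ y p) (h2 : x q ≠ y q) (h3 : x r ≠ y r) : 3 ≤ hammingDist x y := by
  rw [← Finset.card_eq_three.2 ⟨p, q, r, hpq, hpr, hqr, rfl⟩]
  unfold hammingDist
  apply Finset.card_le_card
  intro k hk
  simp only [Finset.mem_insert, Finset.mem_singleton] at hk
  simp only [Finset.mem_filter, Finset.mem_univ, true_and]
  rcases hk with rfl | rfl | rfl <;> assumption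

lemma word_swap {n g : ℕ} {i j : Fin n} (h : i ≠ j) (a b : Fin g) :
    word i j a b = word j i b a := by
  funext k
  by_cases h1 : k = i
  · subst h1; rw [word_left, word_right h.symm]
  by_cases h2 : k = j
  · subst h2; rw [word_left, word_right h]
  rw [word_other h1 h2, word_other h2 h1]

/-- words sharing a coordinate `i` with different entries, other coordinates different -/
lemma dist_share {n g : ℕ} {i j j' : Fin n} (h : i ≠ j) (h' : i ≠ j') (hj : j ≠ j')
    {a b a' b' : Fin g} (ha : a ≠ a') : 3 ≤ hammingDist (word i j a b) (word i j' a' b') := by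
  refine three_le i j j' h h' hj ?_ ?_ ?_
  · rw [word_left, word_left]; simpa using ha
  · rw [word_right h, word_other h.symm hj]; exact Fin.succ_ne_zero _
  · rw [word_right h', word_other h'.symm hj.symm]; exact (Fin.succ_ne_zero _).symm

lemma dist_disj {n g : ℕ} {i j i' j' : Fin n} (h : i ≠ j) (h1 : i ≠ i') (h2 : i ≠ j')
    (h3 : j ≠ i') (h4 : j ≠ j')
    (a b a' b' : Fin g) : 3 ≤ hammingDist (word i j a b) (word i' j' a' b') := by
  refine three_le i j i' h h1 h3 ?_ ?_ ?_
  · rw [word_left, word_other h1 h2]; exact Fin.succ_ne_zero _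
  · rw [word_right h, word_other h3 h4]; exact Fin.succ_ne_zero _
  · rw [word_left, word_other h1.symm h3.symm]; exact (Fin.succ_ne_zero _).symm

lemma isOF_fin {n g : ℕ} (c : Fin n → Fin n → Fin g → Fin g → Fin (g * (n - 1)))
    (hsym : ∀ i j a b, i ≠ j → c i j a b = c j i b a)
    (h1 : ∀ i j, i ≠ j → ∀ a b a' b', c i j a b = c i j a' b' → a = a' ∧ b = b')
    (h2 : ∀ i a j b j' b', i ≠ j → i ≠ j' → c i j a b = c i j' a b' → j = j' ∧ b = b') :
    IsOF n g := by
  classical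
  let Q : Fin (g * (n - 1)) → Finset (Fin n × Fin n × Fin g × Fin g) := fun k =>
    Finset.univ.filter (fun p => p.1 < p.2.1 ∧ c p.1 p.2.1 p.2.2.1 p.2.2.2 = k)
  let W : Fin n × Fin n × Fin g × Fin g → (Fin n → Fin (g + 1)) := fun p =>
    word p.1 p.2.1 p.2.2.1 p.2.2.2
  have hmem : ∀ k x, x ∈ (Q k).image W ↔ ∃ i j a b, i < j ∧ c i j a b = k ∧ x = word i j a b := by
    intro k x
    simp only [Q, W, Finset.mem_image, Finset.mem_filter, Finset.mem_univ, true_and, Prod.exists]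
    constructor
    · rintro ⟨i, j, a, b, ⟨h, h'⟩, rfl⟩; exact ⟨i, j, a, b, h, h', rfl⟩
    · rintro ⟨i, j, a, b, h, h', rfl⟩; exact ⟨i, j, a, b, ⟨h, h'⟩, rfl⟩
  refine ⟨fun k => (Q k).image W, ?_, ?_, ?_, ?_⟩
  · intro k k' hk
    rw [Finset.disjoint_left]
    intro x hx hx'
    obtain ⟨i, j, a, b, h, e, rfl⟩ := (hmem _ _).1 hx
    obtain ⟨i', j', a', b', h', e', he⟩ := (hmem _ _).1 hx'
    obtain ⟨rfl, rfl, rfl, rfl⟩ := word_inj h h' he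
    exact hk (e.symm.trans e')
  · ext x
    simp only [Finset.mem_biUnion, Finset.mem_univ, true_and]
    constructor
    · rintro ⟨k, hk⟩
      obtain ⟨i, j, a, b, h, e, rfl⟩ := (hmem _ _).1 hk
      exact word_mem h.ne a b
    · intro hx
      obtain ⟨i, j, a, b, h, rfl⟩ := exists_word hx
      exact ⟨c i j a b, (hmem _ _).2 ⟨i, j, a, b, h, rfl, rfl⟩⟩
  · intro k
    have hinj : Set.InjOn W (Q k : Set _) := by
      rintro ⟨i, j, a, b⟩ hp ⟨i', j', a', b'⟩ hp' he
      simp only [Q, Finset.coe_filter, Finset.mem_univ, true_and, Set.mem_ofPred_eq] at hp hp'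
      obtain ⟨rfl, rfl, rfl, rfl⟩ := word_inj hp.1 hp'.1 he
      rfl
    rw [Finset.card_image_of_injOn hinj]
    -- the full ordered set
    let R : Finset (Fin n × Fin n × Fin g × Fin g) :=
      Finset.univ.filter (fun p => p.2.1 < p.1 ∧ c p.1 p.2.1 p.2.2.1 p.2.2.2 = k)
    have hQR : (Q k).card = R.card := by
      refine Finset.card_bij (fun p _ => (p.2.1, p.1, p.2.2.2, p.2.2.1)) ?_ ?_ ?_
      · rintro ⟨i, j, a, b⟩ hp
        simp only [Q, R, Finset.mem_filter, Finset.mem_univ, true_and] at hp ⊢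
        exact ⟨hp.1, by rw [← hsym _ _ _ _ hp.1.ne]; exact hp.2⟩
      · rintro ⟨i, j, a, b⟩ _ ⟨i', j', a', b'⟩ _ he
        simp only [Prod.mk.injEq] at he ⊢
        tauto
      · rintro ⟨i, j, a, b⟩ hp
        simp only [R, Finset.mem_filter, Finset.mem_univ, true_and] at hp
        refine ⟨(j, i, b, a), ?_, rfl⟩
        simp only [Q, Finset.mem_filter, Finset.mem_univ, true_and]
        exact ⟨hp.1, by rw [hsym _ _ _ _ hp.1.ne]; exact hp.2⟩
    have hdis : Disjoint (Q k) R := by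
      rw [Finset.disjoint_left]
      rintro ⟨i, j, a, b⟩ hp hp'
      simp only [Q, R, Finset.mem_filter, Finset.mem_univ, true_and] at hp hp'
      exact absurd hp.1 (not_lt.2 hp'.1.le)
    have hsurj : ∀ i : Fin n, ∀ a : Fin g, ∃ j b, i ≠ j ∧ c i j a b = k := by
      intro i a
      let f : {j : Fin n // j ≠ i} × Fin g → Fin (g * (n - 1)) := fun p => c i p.1 a p.2
      have hf : Function.Injective f := by
        rintro ⟨⟨j, hj⟩, b⟩ ⟨⟨j', hj'⟩, b'⟩ he
        obtain ⟨rfl, rfl⟩ := h2 i a j b j' b' hj.symm hj'.symm he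
        rfl
      have hb : Function.Bijective f := by
        rw [Fintype.bijective_iff_injective_and_card]
        refine ⟨hf, ?_⟩
        rw [Fintype.card_prod, Fintype.card_subtype_compl]
        simp [mul_comm]
      obtain ⟨⟨⟨j, hj⟩, b⟩, he⟩ := hb.2 k
      exact ⟨j, b, hj.symm, he⟩
    have hcard : (Q k ∪ R).card = n * g := by
      have : (Q k ∪ R).card = (Finset.univ : Finset (Fin n × Fin g)).card := by
        refine Finset.card_bij (fun p _ => (p.1, p.2.2.1)) (fun _ _ => Finset.mem_univ _) ?_ ?_
        · rintro ⟨i, j, a, b⟩ hp ⟨i', j', a', b'⟩ hp' he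
          simp only [Q, R, Finset.mem_union, Finset.mem_filter, Finset.mem_univ, true_and] at hp hp'
          simp only [Prod.mk.injEq] at he
          obtain ⟨rfl, rfl⟩ := he
          have e1 : i ≠ j ∧ c i j a b = k := by
            rcases hp with hp | hp
            · exact ⟨hp.1.ne, hp.2⟩
            · exact ⟨hp.1.ne', hp.2⟩
          have e2 : i ≠ j' ∧ c i j' a b' = k := by
            rcases hp' with hp | hp
            · exact ⟨hp.1.ne, hp.2⟩
            · exact ⟨hp.1.ne', hp.2⟩
          obtain ⟨rfl, rfl⟩ := h2 i a j b j' b' e1.1 e2.1 (e1.2.trans e2.2.symm)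
          rfl
        · rintro ⟨i, a⟩ _
          obtain ⟨j, b, hij, he⟩ := hsurj i a
          refine ⟨(i, j, a, b), ?_, rfl⟩
          simp only [Q, R, Finset.mem_union, Finset.mem_filter, Finset.mem_univ, true_and]
          rcases lt_or_gt_of_ne hij with h | h
          · exact Or.inl ⟨h, he⟩
          · exact Or.inr ⟨h, he⟩
      rw [this]; simp
    rw [Finset.card_union_of_disjoint hdis, ← hQR] at hcard
    rw [mul_comm g n]
    omega
  · intro k x hx y hy hxy
    obtain ⟨i, j, a, b, h, e, rfl⟩ := (hmem _ _).1 hx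
    obtain ⟨i', j', a', b', h', e', rfl⟩ := (hmem _ _).1 hy
    -- general statement for words sharing the first coordinate
    have key : ∀ i j j' : Fin n, ∀ a b a' b' : Fin g, i ≠ j → i ≠ j' → c i j a b = k →
        c i j' a' b' = k → word i j a b ≠ word i j' a' b' →
        3 ≤ hammingDist (word i j a b) (word i j' a' b') := by
      intro i j j' a b a' b' hij hij' e e' hne
      by_cases hjj : j = j'
      · subst hjj
        obtain ⟨rfl, rfl⟩ := h1 i j hij a b a' b' (e.trans e'.symm)
        exact absurd rfl hne
      · refine dist_share hij hij' hjj ?_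
        rintro rfl
        exact hjj (h2 i a j b j' b' hij hij' (e.trans e'.symm)).1
    by_cases q1 : i = i'
    · subst q1
      exact key i j j' a b a' b' h.ne h'.ne e e' hxy
    by_cases q2 : i = j'
    · subst q2
      rw [word_swap h'.ne] at hxy ⊢
      exact key i j i' a b b' a' h.ne h'.ne' e (by rw [← hsym _ _ _ _ h'.ne]; exact e') hxy
    by_cases q3 : j = i'
    · subst q3
      rw [word_swap h.ne] at hxy ⊢
      exact key j i j' b a a' b' h.ne' h'.ne (by rw [← hsym _ _ _ _ h.ne]; exact e) e' hxy
    by_cases q4 : j = j'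
    · subst q4
      rw [word_swap h.ne, word_swap h'.ne] at hxy ⊢
      exact key j i i' b a b' a' h.ne' h'.ne' (by rw [← hsym _ _ _ _ h.ne]; exact e)
        (by rw [← hsym _ _ _ _ h'.ne]; exact e') hxy
    exact dist_disj h.ne q1 q2 q3 q4 a b a' b'

lemma isOF_of {n g : ℕ} {V K : Type} [Fintype V] [Fintype K]
    (hV : Fintype.card V = n) (hK : Fintype.card K = g * (n - 1))
    (c : V → V → Fin g → Fin g → K)
    (hsym : ∀ i j a b, i ≠ j → c i j a b = c j i b a)
    (h1 : ∀ i j, i ≠ j → ∀ a b a' b', c i j a b = c i j a' b' → a = a' ∧ b = b')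
    (h2 : ∀ i a j b j' b', i ≠ j → i ≠ j' → c i j a b = c i j' a b' → j = j' ∧ b = b') :
    IsOF n g := by
  let e : Fin n ≃ V := (Fintype.equivFinOfCardEq hV).symm
  let f : K ≃ Fin (g * (n - 1)) := Fintype.equivFinOfCardEq hK
  refine isOF_fin (fun i j a b => f (c (e i) (e j) a b)) ?_ ?_ ?_
  · intro i j a b hij
    rw [hsym _ _ _ _ (fun h => hij (e.injective h))]
  · intro i j hij a b a' b' he
    exact h1 _ _ (fun h => hij (e.injective h)) _ _ _ _ (f.injective he)
  · intro i a j b j' b' hj hj' he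
    obtain ⟨p, q⟩ := h2 _ _ _ _ _ _ (fun h => hj (e.injective h)) (fun h => hj' (e.injective h))
      (f.injective he)
    exact ⟨e.injective p, q⟩

lemma two_cancel {m : ℕ} {a b : ZMod (2 * m + 1)} (h : 2 * a = 2 * b) : a = b := by
  have h0 : ((2 * m + 1 : ℕ) : ZMod (2 * m + 1)) = 0 := ZMod.natCast_self _
  push_cast at h0
  linear_combination ((m : ZMod (2 * m + 1)) + 1) * h - (a - b) * h0

lemma valMinAbs_neg_odd {m : ℕ} (a : ZMod (2 * m + 1)) : (-a).valMinAbs = -a.valMinAbs :=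
  ZMod.valMinAbs_neg_of_ne_half (by omega)

lemma natAbs_le {m : ℕ} (a : ZMod (2 * m + 1)) : a.valMinAbs.natAbs ≤ m := by
  have := ZMod.natAbs_valMinAbs_le a
  omega

/-- A one-factorization of the complete graph with additional data. -/
structure Labels (A T : Type) (r : ℕ) where
  τ : A → A → T
  x : A → A → ℕ
  y : A → ℕ
  e : A → Bool
  t0 : T
  τ_symm : ∀ a b, τ a b = τ b a
  x_symm : ∀ a b, x a b = x b a
  x_lt : ∀ a b, x a b < r
  y_lt : ∀ a, y a < r
  row : ∀ a b b', a ≠ b → a ≠ b' → τ a b = τ a b' → b = b'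
  det : ∀ a b a' b', a ≠ b → a' ≠ b' → τ a b = τ a' b' → x a b = x a' b' →
    (a = a' ∧ b = b') ∨ (a = b' ∧ b = a')
  ye : ∀ a b, y a = y b → e a = e b → a = b
  t0_iff : ∀ a b, a ≠ b → (τ a b = t0 ↔ y a = y b)

def labelsAux (m : ℕ) : Labels (Option (ZMod (2 * m + 1))) (ZMod (2 * m + 1)) (m + 1) where
  τ := fun a b => match a, b with
    | some a, some b => a + b
    | some a, none => 2 * a
    | none, some b => 2 * b
    | none, none => 0
  x := fun a b => match a, b with
    | some a, some b => (a - b).valMinAbs.natAbs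
    | _, _ => 0
  y := fun a => match a with
    | some a => a.valMinAbs.natAbs
    | none => 0
  e := fun a => match a with
    | some a => decide (0 < a.valMinAbs)
    | none => true
  t0 := 0
  τ_symm := by
    rintro (_ | a) (_ | b) <;> simp [add_comm]
  x_symm := by
    rintro (_ | a) (_ | b) <;> simp
    rw [← ZMod.natAbs_valMinAbs_neg, neg_sub]
  x_lt := by
    rintro (_ | a) (_ | b) <;> simp
    exact natAbs_le _
  y_lt := by
    rintro (_ | a) <;> simp
    exact natAbs_le _
  row := by
    rintro (_ | a) (_ | b) (_ | b') h h' he <;> simp at h h' he ⊢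
    · exact two_cancel he
    · apply h'; linear_combination he
    · apply h; linear_combination -he
    · exact he
  det := by
    rintro (_ | a) (_ | b) (_ | a') (_ | b') h h' he hx <;> simp at h h' he hx ⊢
    · exact two_cancel he
    · exact two_cancel he
    · exact h' (sub_eq_zero.1 ((ZMod.valMinAbs_eq_zero _).1 (Int.natAbs_eq_zero.1 hx.symm)))
    · exact two_cancel he
    · exact two_cancel he
    · exact h' (sub_eq_zero.1 ((ZMod.valMinAbs_eq_zero _).1 (Int.natAbs_eq_zero.1 hx.symm)))
    · exact h (sub_eq_zero.1 hx)
    · exact h (sub_eq_zero.1 hx)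
    · rcases ZMod.natAbs_valMinAbs_eq_natAbs_valMinAbs.1 hx with h2 | h2
      · left
        have : a = a' := two_cancel (by linear_combination he + h2)
        subst this
        exact ⟨rfl, by linear_combination he⟩
      · right
        have : a = b' := two_cancel (by linear_combination he + h2)
        subst this
        exact ⟨rfl, by linear_combination he⟩
  ye := by
    rintro (_ | a) (_ | b) h h' <;> simp at h h' ⊢
    · omega
    · rw [h] at h'; simp at h'
    · apply ZMod.injective_valMinAbs
      omega
  t0_iff := by
    have h0 : ∀ a : ZMod (2 * m + 1), 2 * a = 0 ↔ a = 0 := fun a =>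
      ⟨fun h => two_cancel (by simpa using h), fun h => by simp [h]⟩
    rintro (_ | a) (_ | b) h <;> simp [h0] at h ⊢
    · rw [eq_comm (a := 0), Int.natAbs_eq_zero, ZMod.valMinAbs_eq_zero]
    · rw [ZMod.natAbs_valMinAbs_eq_natAbs_valMinAbs]
      constructor
      · intro h2; right; linear_combination h2
      · rintro (h2 | h2)
        · exact absurd h2 h
        · linear_combination h2

def Labels.map {A B T U : Type} {r : ℕ} (l : Labels A T r) (f : B ≃ A) (u : T ≃ U) :
    Labels B U r where
  τ := fun a b => u (l.τ (f a) (f b))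
  x := fun a b => l.x (f a) (f b)
  y := fun a => l.y (f a)
  e := fun a => l.e (f a)
  t0 := u l.t0
  τ_symm := fun a b => by rw [l.τ_symm]
  x_symm := fun a b => by rw [l.x_symm]
  x_lt := fun a b => l.x_lt _ _
  y_lt := fun a => l.y_lt _
  row := fun a b b' h h' he => f.injective
    (l.row _ _ _ (fun h2 => h (f.injective h2)) (fun h2 => h' (f.injective h2)) (u.injective he))
  det := fun a b a' b' h h' he hx => by
    rcases l.det _ _ _ _ (fun h2 => h (f.injective h2)) (fun h2 => h' (f.injective h2))
      (u.injective he) hx with ⟨p, q⟩ | ⟨p, q⟩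
    · exact Or.inl ⟨f.injective p, f.injective q⟩
    · exact Or.inr ⟨f.injective p, f.injective q⟩
  ye := fun a b h h' => f.injective (l.ye _ _ h h')
  t0_iff := fun a b h => by
    rw [← l.t0_iff _ _ (fun h2 => h (f.injective h2))]
    exact u.injective.eq_iff

lemma exists_labels {A : Type} [Fintype A] {m : ℕ} (hA : Fintype.card A = 2 * m + 2) :
    Nonempty (Labels A (ZMod (2 * m + 1)) (m + 1)) := by
  have e : A ≃ Option (ZMod (2 * m + 1)) := by
    apply Fintype.equivOfCardEq
    rw [hA, Fintype.card_option, ZMod.card]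
  exact ⟨(labelsAux m).map e (Equiv.refl _)⟩

/-- A skew system. -/
structure Skew (V S : Type) (r : ℕ) where
  L : V → V → S
  σ : ℕ → S → S
  σ_inj : ∀ x, Function.Injective (σ x)
  row : ∀ i j j', i ≠ j → i ≠ j' → L i j = L i j' → j = j'
  col : ∀ i j j', i ≠ j → i ≠ j' → L j i = L j' i → j = j'
  same : ∀ i j, i ≠ j → ∀ x x', x < r → x' < r → σ x (L i j) = σ x' (L i j) → x = x'
  skew : ∀ i j, i ≠ j → ∀ x x', x < r → x' < r → σ x (L i j) ≠ σ x' (L j i)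

/-- off-diagonal colours -/
def offCol {V S T : Type} {g r r' : ℕ} (l : Labels (Fin g) T r') (s : Skew V S r) (i j : V)
    (a b : Fin g) : S :=
  if a < b then s.σ (l.x a b) (s.L i j) else s.σ (l.x a b) (s.L j i)

lemma offCol_symm {V S T : Type} {g r r' : ℕ} (l : Labels (Fin g) T r') (s : Skew V S r) (i j : V)
    {a b : Fin g} (h : a ≠ b) : offCol l s i j a b = offCol l s j i b a := by
  unfold offCol
  rw [l.x_symm b a]
  rcases lt_or_gt_of_ne h with h | h
  · rw [if_pos h, if_neg h.not_gt]
  · rw [if_pos h, if_neg h.not_gt]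

lemma offCol_one {V S T : Type} {g r : ℕ} (l : Labels (Fin g) T r) (s : Skew V S r) {i j : V}
    (hij : i ≠ j) {a b a' b' : Fin g} (h : a ≠ b) (h' : a' ≠ b') (ht : l.τ a b = l.τ a' b')
    (he : offCol l s i j a b = offCol l s i j a' b') : a = a' ∧ b = b' := by
  unfold offCol at he
  have hx := l.x_lt a b
  have hx' := l.x_lt a' b'
  split_ifs at he with q q' q'
  · have := s.same i j hij _ _ hx hx' he
    rcases l.det _ _ _ _ h h' ht this with p | ⟨rfl, rfl⟩
    · exact p
    · exact absurd q q'.not_gt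
  · exact absurd he (s.skew i j hij _ _ hx hx')
  · exact absurd he.symm (s.skew i j hij _ _ hx' hx)
  · have := s.same j i hij.symm _ _ hx hx' he
    rcases l.det _ _ _ _ h h' ht this with p | ⟨rfl, rfl⟩
    · exact p
    · exact absurd (lt_of_le_of_ne (not_lt.1 q') h) q

lemma offCol_two {V S T : Type} {g r r' : ℕ} (l : Labels (Fin g) T r') (s : Skew V S r) {i j j' : V}
    (hij : i ≠ j) (hij' : i ≠ j') {a b b' : Fin g} (h : a ≠ b) (h' : a ≠ b')
    (ht : l.τ a b = l.τ a b')
    (he : offCol l s i j a b = offCol l s i j' a b') : j = j' ∧ b = b' := by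
  obtain rfl := l.row _ _ _ h h' ht
  refine ⟨?_, rfl⟩
  unfold offCol at he
  split_ifs at he with q
  · exact s.row _ _ _ hij hij' (s.σ_inj _ he)
  · exact s.col _ _ _ hij hij' (s.σ_inj _ he)

lemma natCast_inj_lt {N x y : ℕ} (hx : x < N) (hy : y < N)
    (h : (x : ZMod N) = (y : ZMod N)) : x = y := by
  have := (ZMod.natCast_eq_natCast_iff' _ _ _).1 h
  rwa [Nat.mod_eq_of_lt hx, Nat.mod_eq_of_lt hy] at this

/-- The even case. -/
lemma isOF_even {n g m k : ℕ} {V S : Type} [Fintype V] [Fintype S] (hg : g = 2 * m + 2)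
    (hn : n = 2 * k + 2) (hgn : g < n) (hV : Fintype.card V = n) (hS : Fintype.card S = n - 1)
    (s : Skew V S (m + 1)) : IsOF n g := by
  obtain ⟨l⟩ := exists_labels (A := Fin g) (m := m) (by simpa using hg)
  obtain ⟨d⟩ := exists_labels (A := V) (m := k) (by rw [hV, hn])
  let c : V → V → Fin g → Fin g → (ZMod (2 * m + 1) × S) ⊕ ZMod (2 * k + 1) := fun i j a b =>
    if a = b then Sum.inr (d.τ i j + (a : ℕ)) else Sum.inl (l.τ a b, offCol l s i j a b)
  refine isOF_of (V := V) (K := (ZMod (2 * m + 1) × S) ⊕ ZMod (2 * k + 1)) hV ?_ c ?_ ?_ ?_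
  · rw [Fintype.card_sum, Fintype.card_prod, ZMod.card, ZMod.card, hS, hg, hn]
    have : 2 * k + 2 - 1 = 2 * k + 1 := by omega
    rw [this]; ring
  · intro i j a b hij
    by_cases h : a = b
    · subst h
      simp [c, d.τ_symm i j]
    · have h' : b ≠ a := fun q => h q.symm
      simp only [c, if_neg h, if_neg h']
      rw [l.τ_symm a b, offCol_symm l s i j h]
  · intro i j hij a b a' b' he
    by_cases h : a = b <;> by_cases h' : a' = b'
    · simp only [c, if_pos h, if_pos h', Sum.inr.injEq, add_right_inj] at he
      have h2 := natCast_inj_lt (by omega) (by omega) he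
      have : a = a' := Fin.ext h2
      subst h h' this
      exact ⟨rfl, rfl⟩
    · simp [c, if_pos h, if_neg h'] at he
    · simp [c, if_neg h, if_pos h'] at he
    · simp only [c, if_neg h, if_neg h', Sum.inl.injEq, Prod.mk.injEq] at he
      exact offCol_one l s hij h h' he.1 he.2
  · intro i a j b j' b' hj hj' he
    by_cases h : a = b <;> by_cases h' : a = b'
    · simp only [c, if_pos h, if_pos h', Sum.inr.injEq, add_left_inj] at he
      exact ⟨d.row _ _ _ hj hj' he, h ▸ h'⟩
    · simp [c, if_pos h, if_neg h'] at he
    · simp [c, if_neg h, if_pos h'] at he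
    · simp only [c, if_neg h, if_neg h', Sum.inl.injEq, Prod.mk.injEq] at he
      exact offCol_two l s hj hj' h h' he.1 he.2

lemma cast_inj_pos {h x y : ℕ} (hx : 1 ≤ x) (hxh : x ≤ h) (hy : 1 ≤ y) (hyh : y ≤ h)
    (he : (x : ZMod h) = (y : ZMod h)) : x = y := by
  have : ((x - 1 : ℕ) : ZMod h) = ((y - 1 : ℕ) : ZMod h) := by
    push_cast [hx, hy]
    rw [he]
  have := natCast_inj_lt (by omega) (by omega) this
  omega

lemma natAbs_pos {m : ℕ} {a : ZMod (2 * m + 1)} (h : a ≠ 0) : 1 ≤ a.valMinAbs.natAbs := by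
  have : a.valMinAbs ≠ 0 := fun h2 => h ((ZMod.valMinAbs_eq_zero _).1 h2)
  omega

/-- signed differences -/
def dlt {h : ℕ} (z : ZMod (2 * h + 1)) : ZMod h × Bool :=
  ((z.valMinAbs.natAbs : ZMod h), decide (0 < z.valMinAbs))

lemma dlt_inj {h : ℕ} {z z' : ZMod (2 * h + 1)} (hz : z ≠ 0) (hz' : z' ≠ 0)
    (he : dlt z = dlt z') : z = z' := by
  simp only [dlt, Prod.mk.injEq, decide_eq_decide] at he
  have := cast_inj_pos (natAbs_pos hz) (natAbs_le z) (natAbs_pos hz') (natAbs_le z') he.1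
  apply ZMod.injective_valMinAbs
  have := he.2
  omega

lemma dlt_neg {h : ℕ} {z : ZMod (2 * h + 1)} (hz : z ≠ 0) : (dlt (-z)).2 ≠ (dlt z).2 := by
  have := natAbs_pos hz
  simp only [dlt, ne_eq, decide_eq_decide, valMinAbs_neg_odd]
  omega

/-- shift of signed differences -/
def sh {h : ℕ} (x : ℕ) (p : ZMod h × Bool) : ZMod h × Bool := (p.1 + x, p.2)

lemma sh_inj {h : ℕ} (x : ℕ) : Function.Injective (sh (h := h) x) := by
  rintro ⟨a, b⟩ ⟨c, d⟩ he
  simpa [sh] using he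

lemma sh_same {h x x' : ℕ} (hx : x < h) (hx' : x' < h) (p : ZMod h × Bool)
    (he : sh x p = sh x' p) : x = x' := by
  simp only [sh, Prod.mk.injEq, add_right_inj, and_true] at he
  exact natCast_inj_lt hx hx' he

def oddSkew {h r : ℕ} (hr : r ≤ h) : Skew (ZMod (2 * h + 1)) (ZMod h × Bool) r where
  L := fun i j => dlt (j - i)
  σ := sh
  σ_inj := sh_inj
  row := fun i j j' hj hj' he => by
    have := dlt_inj (sub_ne_zero.2 hj.symm) (sub_ne_zero.2 hj'.symm) he
    linear_combination this
  col := fun i j j' hj hj' he => by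
    have := dlt_inj (sub_ne_zero.2 hj) (sub_ne_zero.2 hj') he
    linear_combination -this
  same := fun i j hij x x' hx hx' he => sh_same (by omega) (by omega) _ he
  skew := fun i j hij x x' hx hx' he => by
    have h2 := congrArg Prod.snd he
    have h3 : (dlt (-(i - j))).2 ≠ (dlt (i - j)).2 := dlt_neg (sub_ne_zero.2 hij)
    rw [neg_sub] at h3
    exact h3 h2

/-- three-colouring of the cycles of step `d` -/
def wc {h : ℕ} (d : ℕ) (i : ZMod (2 * h + 1)) : Fin 3 :=
  if 2 * h + 1 ≤ i.val + d then 2 else if (i.val / d) % 2 = 0 then 0 else 1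

lemma wc_ne {h d : ℕ} (hd : 1 ≤ d) (hdh : d ≤ h) {i j : ZMod (2 * h + 1)} (hj : j = i + d) :
    wc d i ≠ wc d j := by
  have hi := ZMod.val_lt i
  have hv : j.val = (i.val + d) % (2 * h + 1) := by
    rw [hj, ZMod.val_add, ZMod.val_natCast]
    simp
  by_cases q : 2 * h + 1 ≤ i.val + d
  · have hv' : j.val = i.val + d - (2 * h + 1) := by
      rw [hv, Nat.mod_eq_sub_mod q, Nat.mod_eq_of_lt (by omega)]
    have q' : ¬ (2 * h + 1 ≤ j.val + d) := by omega
    simp only [wc, if_pos q, if_neg q']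
    split_ifs <;> decide
  · have hv' : j.val = i.val + d := by
      rw [hv, Nat.mod_eq_of_lt (by omega)]
    have hdiv : j.val / d = i.val / d + 1 := by
      rw [hv', Nat.add_div_right _ (by omega)]
    simp only [wc, if_neg q, hdiv]
    split_ifs <;> first | decide | omega

def ell (u : Fin 3) (c : Bool × Bool) : Bool :=
  if u = 0 then c.1 else if u = 1 then c.2 else xor c.1 c.2

lemma exists_col (u v : Fin 3) (h : u ≠ v) (p q : Bool) :
    ∃ c : Bool × Bool, ell u c = p ∧ ell v c = !q := by
  revert u v p q
  decide

lemma exists_col_fun : ∃ col : Fin 3 → Fin 3 → Bool → Bool → Bool × Bool,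
    ∀ u v, u ≠ v → ∀ p q, ell u (col u v p q) = p ∧ ell v (col u v p q) = !q := by
  classical
  refine ⟨fun u v p q => if h : u ≠ v then (exists_col u v h p q).choose else (false, false), ?_⟩
  intro u v h p q
  simp only [dif_pos h]
  exact (exists_col u v h p q).choose_spec

/-- colours for the odd case -/
abbrev OddCol (m h : ℕ) (t0 : ZMod (2 * m + 1)) : Type :=
  ({t : ZMod (2 * m + 1) // t ≠ t0} × (ZMod h × Bool)) ⊕ (ZMod h × (Bool × Bool))

/-- The odd case. -/
lemma isOF_odd {n g m h : ℕ} (hg : g = 2 * m + 2) (hn : n = 2 * h + 1) (hgn : g < n) :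
    IsOF n g := by
  classical
  have hmh : m + 1 ≤ h := by omega
  have : NeZero h := ⟨by omega⟩
  obtain ⟨l⟩ := exists_labels (A := Fin g) (m := m) (by simpa using hg)
  obtain ⟨col, hcol⟩ := exists_col_fun
  let V := ZMod (2 * h + 1)
  let s : Skew V (ZMod h × Bool) (m + 1) := oddSkew hmh
  let v : V → V → ℤ := fun i j => (j - i).valMinAbs
  have vneg : ∀ i j, v j i = - v i j := by
    intro i j
    simp only [v]
    rw [← valMinAbs_neg_odd, neg_sub]
  have vne : ∀ i j, i ≠ j → v i j ≠ 0 := fun i j hij h0 =>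
    (sub_ne_zero.2 hij.symm) ((ZMod.valMinAbs_eq_zero _).1 h0)
  have vle : ∀ i j, (v i j).natAbs ≤ h := fun i j => natAbs_le _
  have vinj : ∀ i j j', v i j = v i j' → j = j' := by
    intro i j j' he
    have := ZMod.injective_valMinAbs he
    linear_combination this
  have wne' : ∀ i j, 0 < v i j → wc (v i j).natAbs i ≠ wc (v i j).natAbs j := by
    intro i j hp
    refine wc_ne (by omega) (vle i j) ?_
    have h1 : (((v i j).natAbs : ℤ) : ZMod (2 * h + 1)) = j - i := by
      rw [Int.natAbs_of_nonneg hp.le]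
      exact ZMod.coe_valMinAbs _
    rw [Int.cast_natCast] at h1
    rw [h1]; ring
  have wne : ∀ i j, i ≠ j → wc (v i j).natAbs i ≠ wc (v i j).natAbs j := by
    intro i j hij
    rcases lt_or_gt_of_ne (vne i j hij) with hp | hp
    · have := wne' j i (by rw [vneg]; omega)
      rw [vneg i j, Int.natAbs_neg] at this
      exact this.symm
    · exact wne' i j hp
  let B : V → V → Fin g → Fin g → Bool × Bool := fun i j a b =>
    if 0 < v i j then col (wc (v i j).natAbs i) (wc (v i j).natAbs j) (l.e a) (l.e b)
    else col (wc (v i j).natAbs j) (wc (v i j).natAbs i) (l.e b) (l.e a)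
  have Bpos : ∀ i j a b, 0 < v i j → ell (wc (v i j).natAbs i) (B i j a b) = l.e a ∧
      ell (wc (v i j).natAbs j) (B i j a b) = !(l.e b) := by
    intro i j a b hp
    simp only [B, if_pos hp]
    exact hcol _ _ (wne' i j hp) _ _
  have Bneg : ∀ i j a b, v i j < 0 → ell (wc (v i j).natAbs j) (B i j a b) = l.e b ∧
      ell (wc (v i j).natAbs i) (B i j a b) = !(l.e a) := by
    intro i j a b hp
    simp only [B, if_neg hp.not_gt]
    refine hcol _ _ (wne i j ?_).symm _ _
    rintro rfl
    simp [v] at hp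
  have Binj : ∀ i j, i ≠ j → ∀ a b a' b', B i j a b = B i j a' b' →
      l.e a = l.e a' ∧ l.e b = l.e b' := by
    intro i j hij a b a' b' he
    rcases lt_or_gt_of_ne (vne i j hij) with hp | hp
    · have p1 := Bneg i j a b hp
      have p2 := Bneg i j a' b' hp
      rw [he] at p1
      exact ⟨Bool.not_inj (p1.2.symm.trans p2.2), p1.1.symm.trans p2.1⟩
    · have p1 := Bpos i j a b hp
      have p2 := Bpos i j a' b' hp
      rw [he] at p1
      exact ⟨p1.1.symm.trans p2.1, Bool.not_inj (p1.2.symm.trans p2.2)⟩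
  have hy_ne : ∀ a b, l.y a ≠ l.y b → a ≠ b := fun a b hy hab => hy (by rw [hab])
  have hτ : ∀ a b, l.y a ≠ l.y b → l.τ a b ≠ l.t0 := fun a b hy ht =>
    hy ((l.t0_iff a b (hy_ne a b hy)).1 ht)
  let c : V → V → Fin g → Fin g → OddCol m h l.t0 := fun i j a b =>
    if hy : l.y a = l.y b then Sum.inr (((v i j).natAbs : ZMod h) + (l.y a : ℕ), B i j a b)
    else Sum.inl (⟨l.τ a b, hτ a b hy⟩, offCol l s i j a b)
  refine isOF_of (V := V) (K := OddCol m h l.t0) (by rw [ZMod.card, hn]) ?_ c ?_ ?_ ?_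
  · rw [Fintype.card_sum, Fintype.card_prod, Fintype.card_prod, Fintype.card_prod,
      Fintype.card_prod, Fintype.card_subtype_compl, Fintype.card_subtype_eq, ZMod.card, ZMod.card,
      Fintype.card_bool, hg, hn]
    have e1 : 2 * m + 1 - 1 = 2 * m := by omega
    have e2 : 2 * h + 1 - 1 = 2 * h := by omega
    rw [e1, e2]; ring
  · intro i j a b hij
    by_cases hy : l.y a = l.y b
    · simp only [c, dif_pos hy, dif_pos hy.symm]
      rw [vneg i j, Int.natAbs_neg, hy]
      congr 2
      simp only [B]
      rw [vneg i j, Int.natAbs_neg]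
      have := vne i j hij
      rcases lt_or_gt_of_ne this with hp | hp
      · rw [if_neg hp.not_gt, if_pos (by omega)]
      · rw [if_pos hp, if_neg (by omega)]
    · have hy' : ¬ l.y b = l.y a := fun q => hy q.symm
      simp only [c, dif_neg hy, dif_neg hy']
      rw [offCol_symm l s i j (hy_ne a b hy)]
      simp only [l.τ_symm a b]
  · intro i j hij a b a' b' he
    by_cases hy : l.y a = l.y b <;> by_cases hy' : l.y a' = l.y b'
    · simp only [c, dif_pos hy, dif_pos hy', Sum.inr.injEq, Prod.mk.injEq, add_right_inj] at he
      have h1 := l.y_lt a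
      have h2 := l.y_lt a'
      have h3 := natCast_inj_lt (by omega) (by omega) he.1
      have h4 := Binj i j hij _ _ _ _ he.2
      exact ⟨l.ye _ _ h3 h4.1, l.ye _ _ (by omega) h4.2⟩
    · simp [c, dif_pos hy, dif_neg hy'] at he
    · simp [c, dif_neg hy, dif_pos hy'] at he
    · simp only [c, dif_neg hy, dif_neg hy', Sum.inl.injEq, Prod.mk.injEq, Subtype.mk.injEq] at he
      exact offCol_one l s hij (hy_ne _ _ hy) (hy_ne _ _ hy') he.1 he.2
  · intro i a j b j' b' hj hj' he
    by_cases hy : l.y a = l.y b <;> by_cases hy' : l.y a = l.y b'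
    · simp only [c, dif_pos hy, dif_pos hy', Sum.inr.injEq, Prod.mk.injEq, add_left_inj] at he
      have n1 := vne i j hj
      have n2 := vne i j' hj'
      have h3 := cast_inj_pos (by omega) (vle i j) (by omega) (vle i j') he.1
      rcases lt_or_gt_of_ne n1 with p1 | p1 <;> rcases lt_or_gt_of_ne n2 with p2 | p2
      · have : j = j' := vinj i j j' (by omega)
        subst this
        exact ⟨rfl, l.ye _ _ (by omega) (Binj i j hj _ _ _ _ he.2).2⟩
      · have q1 := (Bneg i j a b p1).2
        have q2 := (Bpos i j' a b' p2).1
        rw [he.2, h3, q2] at q1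
        simp at q1
      · have q1 := (Bpos i j a b p1).1
        have q2 := (Bneg i j' a b' p2).2
        rw [he.2, h3, q2] at q1
        simp at q1
      · have : j = j' := vinj i j j' (by omega)
        subst this
        exact ⟨rfl, l.ye _ _ (by omega) (Binj i j hj _ _ _ _ he.2).2⟩
    · simp [c, dif_pos hy, dif_neg hy'] at he
    · simp [c, dif_neg hy, dif_pos hy'] at he
    · simp only [c, dif_neg hy, dif_neg hy', Sum.inl.injEq, Prod.mk.injEq, Subtype.mk.injEq] at he
      exact offCol_two l s hj hj' (hy_ne _ _ hy) (hy_ne _ _ hy') he.1 he.2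

/-- shift of all symbols -/
def sh2 {h b : ℕ} (x : ℕ) : (ZMod h × Bool) ⊕ ZMod b → (ZMod h × Bool) ⊕ ZMod b
  | Sum.inl p => Sum.inl (sh x p)
  | Sum.inr z => Sum.inr (z + x)

lemma sh2_same {h b x x' : ℕ} (hx : x < h) (hx' : x' < h) (hb : x < b) (hb' : x' < b)
    (p : (ZMod h × Bool) ⊕ ZMod b) (he : sh2 x p = sh2 x' p) : x = x' := by
  rcases p with p | p
  · simp only [sh2, Sum.inl.injEq] at he
    exact sh_same hx hx' p he
  · simp only [sh2, Sum.inr.injEq, add_right_inj] at he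
    exact natCast_inj_lt hb hb' he

lemma sh2_snd {h b x x' : ℕ} {p p' : ZMod h × Bool}
    (he : sh2 (b := b) x (Sum.inl p) = sh2 x' (Sum.inl p')) : p.2 = p'.2 := by
  simp only [sh2, Sum.inl.injEq, sh, Prod.mk.injEq] at he
  exact he.2

/-- A skew system on the union of two odd cyclic groups. -/
def mkSkew {h b r sn : ℕ} (hr : r ≤ h) (hs : r ≤ sn) (hsb : sn + r ≤ b)
    (ι : ZMod (2 * h + 1) → ZMod b) (hι : Function.Injective ι)
    (β : ZMod b → ZMod b → (ZMod h × Bool) ⊕ ZMod b)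
    (brow : ∀ y z z', y ≠ z → y ≠ z' → β y z = β y z' → z = z')
    (bcol : ∀ y z z', y ≠ z → y ≠ z' → β z y = β z' y → z = z')
    (brow' : ∀ y z u, y ≠ z → β y z ≠ Sum.inr (y - ι u + sn))
    (bcol' : ∀ y z u, y ≠ z → β z y ≠ Sum.inr (y - ι u))
    (bskew : ∀ y z, y ≠ z → ∀ x x', sh2 x (β y z) ≠ sh2 x' (β z y)) :
    Skew (ZMod (2 * h + 1) ⊕ ZMod b) ((ZMod h × Bool) ⊕ ZMod b) r where
  L := fun i j => match i, j with
    | Sum.inl u, Sum.inl v => Sum.inl (dlt (v - u))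
    | Sum.inl u, Sum.inr y => Sum.inr (y - ι u)
    | Sum.inr y, Sum.inl u => Sum.inr (y - ι u + sn)
    | Sum.inr y, Sum.inr z => β y z
  σ := sh2
  σ_inj := by
    rintro x (p | z) (p' | z') he <;> simp [sh2] at he ⊢
    · exact sh_inj x he
    · exact he
  row := by
    rintro (i | i) (j | j) (k | k) hj hk he <;> simp at hj hk he ⊢
    · exact (oddSkew hr).row i j k hj hk he
    · exact he
    · exact hι he
    · exact brow' _ _ _ hk he.symm
    · exact brow' _ _ _ hj he
    · exact brow _ _ _ hj hk he
  col := by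
    rintro (i | i) (j | j) (k | k) hj hk he <;> simp at hj hk he ⊢
    · exact (oddSkew hr).col i j k hj hk he
    · exact he
    · exact hι he
    · exact bcol' _ _ _ hk he.symm
    · exact bcol' _ _ _ hj he
    · exact bcol _ _ _ hj hk he
  same := by
    intro i j _ x x' hx hx' he
    exact sh2_same (by omega) (by omega) (by omega) (by omega) _ he
  skew := by
    rintro (i | i) (j | j) hij x x' hx hx' he <;> simp only [sh2, Sum.inl.injEq, Sum.inr.injEq] at he
    · exact (oddSkew hr).skew i j (by simpa using hij) x x' hx hx' he
    · have : ((x : ℕ) : ZMod b) = ((sn + x' : ℕ) : ZMod b) := by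
        push_cast; linear_combination he
      have := natCast_inj_lt (by omega) (by omega) this
      omega
    · have : ((x' : ℕ) : ZMod b) = ((sn + x : ℕ) : ZMod b) := by
        push_cast; linear_combination -he
      have := natCast_inj_lt (by omega) (by omega) this
      omega
    · exact bskew i j (by simpa using hij) x x' he

/-- case `n = 2(2h+1)` -/
def skewA {h r : ℕ} (hr : r ≤ h) :
    Skew (ZMod (2 * h + 1) ⊕ ZMod (2 * h + 1)) ((ZMod h × Bool) ⊕ ZMod (2 * h + 1)) r :=
  mkSkew (sn := h) hr hr (by omega) id Function.injective_id
    (fun y z => Sum.inl (dlt (z - y)))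
    (fun y z z' hz hz' he => (oddSkew hr).row y z z' hz hz' (Sum.inl_injective he))
    (fun y z z' hz hz' he => (oddSkew hr).col y z z' hz hz' (Sum.inl_injective he))
    (fun y z u _ he => by simp at he)
    (fun y z u _ he => by simp at he)
    (fun y z hyz x x' he => by
      have h2 : (dlt (z - y)).2 = (dlt (y - z)).2 := sh2_snd he
      have h3 : (dlt (-(y - z))).2 ≠ (dlt (y - z)).2 := dlt_neg (sub_ne_zero.2 hyz)
      rw [neg_sub] at h3
      exact h3 h2)

/-- index of a difference in the larger group -/
def kap (h : ℕ) (v : ℤ) : ZMod h × Bool :=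
  (((if v.natAbs = h + 1 then h else v.natAbs : ℕ) : ZMod h), decide (0 < v))

lemma kap_inj {h : ℕ} {v v' : ℤ} (h1 : 1 ≤ h) (hv : v ≠ 0) (hv' : v' ≠ 0)
    (hl : v.natAbs ≤ h + 1) (hl' : v'.natAbs ≤ h + 1)
    (a1 : v ≠ h) (a2 : v ≠ -(h + 1)) (a1' : v' ≠ h) (a2' : v' ≠ -(h + 1))
    (he : kap h v = kap h v') : v = v' := by
  simp only [kap, Prod.mk.injEq, decide_eq_decide] at he
  have := cast_inj_pos (by split_ifs <;> omega) (by split_ifs <;> omega)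
    (by split_ifs <;> omega) (by split_ifs <;> omega) he.1
  have := he.2
  split_ifs at * <;> omega

def beta {h : ℕ} (y z : ZMod (2 * (h + 1) + 1)) :
    (ZMod h × Bool) ⊕ ZMod (2 * (h + 1) + 1) :=
  if (z - y).valMinAbs = h then Sum.inr (y + h)
  else if (z - y).valMinAbs = -(h + 1) then Sum.inr (y + h + 1)
  else Sum.inl (kap h (z - y).valMinAbs)

lemma beta_cases {h : ℕ} (y z : ZMod (2 * (h + 1) + 1)) :
    (z = y + h ∧ beta y z = Sum.inr (y + h)) ∨
    (z = y - (h + 1) ∧ beta y z = Sum.inr (y + h + 1)) ∨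
    ((z - y).valMinAbs ≠ h ∧ (z - y).valMinAbs ≠ -(h + 1) ∧
      beta y z = Sum.inl (kap h (z - y).valMinAbs)) := by
  have hc := ZMod.coe_valMinAbs (z - y)
  unfold beta
  split_ifs with h1 h2
  · left
    refine ⟨?_, rfl⟩
    rw [h1] at hc
    push_cast at hc
    linear_combination -hc
  · right; left
    refine ⟨?_, rfl⟩
    rw [h2] at hc
    push_cast at hc
    linear_combination -hc
  · right; right
    exact ⟨h1, h2, rfl⟩

lemma vm_ne {m : ℕ} {y z : ZMod (2 * m + 1)} (h : y ≠ z) : (z - y).valMinAbs ≠ 0 := fun h0 =>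
  (sub_ne_zero.2 h.symm) ((ZMod.valMinAbs_eq_zero _).1 h0)

/-- case `n = (2h+1) + (2h+3)` -/
def skewB {h r : ℕ} (h1 : 1 ≤ h) (hr : r ≤ h) :
    Skew (ZMod (2 * h + 1) ⊕ ZMod (2 * (h + 1) + 1))
      ((ZMod h × Bool) ⊕ ZMod (2 * (h + 1) + 1)) r :=
  have hb : (2 * ((h : ZMod (2 * (h + 1) + 1)) + 1) + 1) = 0 := by
    have := ZMod.natCast_self (2 * (h + 1) + 1)
    push_cast at this
    exact this
  have h10 : (1 : ZMod (2 * (h + 1) + 1)) ≠ 0 := by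
    intro h0
    have : ((1 : ℕ) : ZMod (2 * (h + 1) + 1)) = ((0 : ℕ) : ZMod (2 * (h + 1) + 1)) := by
      simpa using h0
    have := natCast_inj_lt (by omega) (by omega) this
    omega
  have hι0 : ∀ u : ZMod (2 * h + 1), ((u.val + 2 : ℕ) : ZMod (2 * (h + 1) + 1)) ≠ 0 := by
    intro u h0
    have hu := ZMod.val_lt u
    have : ((u.val + 2 : ℕ) : ZMod (2 * (h + 1) + 1)) = ((0 : ℕ) : ZMod (2 * (h + 1) + 1)) := by
      rw [h0]; simp
    have := natCast_inj_lt (by omega) (by omega) this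
    omega
  have hι1 : ∀ u : ZMod (2 * h + 1), ((u.val + 2 : ℕ) : ZMod (2 * (h + 1) + 1)) ≠ 1 := by
    intro u h0
    have hu := ZMod.val_lt u
    have : ((u.val + 2 : ℕ) : ZMod (2 * (h + 1) + 1)) = ((1 : ℕ) : ZMod (2 * (h + 1) + 1)) := by
      rw [h0]; simp
    have := natCast_inj_lt (by omega) (by omega) this
    omega
  mkSkew (sn := h + 1) hr (by omega) (by omega)
    (fun u => ((u.val + 2 : ℕ) : ZMod (2 * (h + 1) + 1)))
    (fun u u' he => by
      have hu := ZMod.val_lt u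
      have hu' := ZMod.val_lt u'
      have := natCast_inj_lt (by omega) (by omega) he
      exact ZMod.val_injective _ (by omega))
    beta
    (fun y z z' hz hz' he => by
      rcases beta_cases y z with ⟨e1, e2⟩ | ⟨e1, e2⟩ | ⟨e1, e1', e2⟩ <;>
      rcases beta_cases y z' with ⟨f1, f2⟩ | ⟨f1, f2⟩ | ⟨f1, f1', f2⟩ <;>
      rw [e2, f2] at he <;>
      simp only [Sum.inl.injEq, Sum.inr.injEq, reduceCtorEq] at he
      · rw [e1, f1]
      · exact absurd (by linear_combination -he) h10
      · exact absurd (by linear_combination he) h10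
      · rw [e1, f1]
      · have := ZMod.injective_valMinAbs (kap_inj h1 (vm_ne hz) (vm_ne hz') (natAbs_le _)
          (natAbs_le _) e1 e1' f1 f1' he)
        linear_combination this)
    (fun y z z' hz hz' he => by
      rcases beta_cases z y with ⟨e1, e2⟩ | ⟨e1, e2⟩ | ⟨e1, e1', e2⟩ <;>
      rcases beta_cases z' y with ⟨f1, f2⟩ | ⟨f1, f2⟩ | ⟨f1, f1', f2⟩ <;>
      rw [e2, f2] at he <;>
      simp only [Sum.inl.injEq, Sum.inr.injEq, reduceCtorEq] at he
      · linear_combination f1 - e1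
      · exact absurd (by linear_combination he + e1 - f1 + hb) h10
      · exact absurd (by linear_combination -he + f1 - e1 + hb) h10
      · linear_combination f1 - e1
      · have := ZMod.injective_valMinAbs (kap_inj h1 (vm_ne hz.symm) (vm_ne hz'.symm) (natAbs_le _)
          (natAbs_le _) e1 e1' f1 f1' he)
        linear_combination -this)
    (fun y z u hyz he => by
      rcases beta_cases y z with ⟨e1, e2⟩ | ⟨e1, e2⟩ | ⟨e1, e1', e2⟩ <;>
      rw [e2] at he <;>
      simp only [Sum.inr.injEq, reduceCtorEq] at he
      · refine hι1 u ?_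
        push_cast at he ⊢
        linear_combination he
      · refine hι0 u ?_
        push_cast at he ⊢
        linear_combination he)
    (fun y z u hyz he => by
      rcases beta_cases z y with ⟨e1, e2⟩ | ⟨e1, e2⟩ | ⟨e1, e1', e2⟩ <;>
      rw [e2] at he <;>
      simp only [Sum.inr.injEq, reduceCtorEq] at he
      · refine hι0 u ?_
        push_cast at he ⊢
        linear_combination he + e1
      · refine hι1 u ?_
        push_cast at he ⊢
        linear_combination he + e1 - hb)
    (fun y z hyz x x' he => by
      have hne := vm_ne hyz
      have hng : (y - z).valMinAbs = - (z - y).valMinAbs := by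
        rw [← valMinAbs_neg_odd, neg_sub]
      have key : ∀ y z : ZMod (2 * (h + 1) + 1), y ≠ z →
          ∀ p, beta y z = Sum.inr p → ∀ p', beta z y ≠ Sum.inr p' := by
        intro y z hyz p hp p' hp'
        have hng : (y - z).valMinAbs = - (z - y).valMinAbs := by
          rw [← valMinAbs_neg_odd, neg_sub]
        unfold beta at hp hp'
        rw [hng] at hp'
        split_ifs at hp hp' <;> omega
      rcases hp : beta y z with p | p <;> rcases hp' : beta z y with p' | p'
      · rw [hp, hp'] at he
        have h2 : p.2 = p'.2 := sh2_snd he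
        unfold beta at hp hp'
        rw [hng] at hp'
        split_ifs at hp hp'
        have q := congrArg Prod.snd (Sum.inl_injective hp)
        have q' := congrArg Prod.snd (Sum.inl_injective hp')
        rw [← q, ← q'] at h2
        simp only [kap, decide_eq_decide] at h2
        omega
      · rw [hp, hp'] at he; simp [sh2] at he
      · rw [hp, hp'] at he; simp [sh2] at he
      · exact key y z hyz p hp p' hp')

end OFaux

/-- Let `g ≥ 4` be even and `n > g` with neither (`n` odd and `g+3 ≤ n ≤ 2g-3`)
nor (`n` even and `g+2 ≤ n ≤ 4g-4`). Then an `OF(n,g)` exists. -/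
theorem exists_OF_even_g (n g : ℕ) (hg4 : 4 ≤ g) (hge : Even g) (hng : g < n)
    (h1 : ¬(Odd n ∧ g + 3 ≤ n ∧ n ≤ 2 * g - 3))
    (h2 : ¬(Even n ∧ g + 2 ≤ n ∧ n ≤ 4 * g - 4)) : IsOF n g := by
  obtain ⟨m', hm'⟩ := hge
  obtain ⟨m, rfl⟩ : ∃ m, m' = m + 1 := ⟨m' - 1, by omega⟩
  have hg : g = 2 * m + 2 := by omega
  rcases Nat.even_or_odd n with hn | hn
  · have hn4 : 4 * g - 2 ≤ n := by
      by_contra hc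
      obtain ⟨k, hk⟩ := hn
      exact h2 ⟨⟨k, hk⟩, by omega, by omega⟩
    obtain ⟨k, hk⟩ := hn
    rcases Nat.even_or_odd k with ⟨p, hp⟩ | ⟨h, hh⟩
    · -- `n = (2h+1) + (2h+3)`
      obtain ⟨h, rfl⟩ : ∃ h, p = h + 1 := ⟨p - 1, by omega⟩
      have : NeZero h := ⟨by omega⟩
      refine OFaux.isOF_even (k := k - 1) hg (by omega) hng ?_ ?_
        (OFaux.skewB (h := h) (r := m + 1) (by omega) (by omega))
      · rw [Fintype.card_sum, ZMod.card, ZMod.card]; omega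
      · rw [Fintype.card_sum, Fintype.card_prod, ZMod.card, ZMod.card, Fintype.card_bool]; omega
    · have : NeZero h := ⟨by omega⟩
      refine OFaux.isOF_even (k := k - 1) hg (by omega) hng ?_ ?_
        (OFaux.skewA (h := h) (r := m + 1) (by omega))
      · rw [Fintype.card_sum, ZMod.card]; omega
      · rw [Fintype.card_sum, Fintype.card_prod, ZMod.card, ZMod.card, Fintype.card_bool]; omega
  · obtain ⟨h, hh⟩ := hn
    exact OFaux.isOF_odd hg hh hng
end

section
/- Let g ≥ 5 be an odd integer and let n > g be an even integer such that neither (n ≡ 2 (mod 4) and n ≤ 2g−4) nor (n ≡ 0 (mod 4) and n ≤ 4g−4) holds. Then an OF(n,g) exists. -/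
open Finset in
theorem isOF_of_kappa {n g : ℕ} {C : Type} [Fintype C] [DecidableEq C]
    (hC : Fintype.card C = g * (n - 1))
    (κ : Fin n → Fin n → Fin (g + 1) → Fin (g + 1) → C)
    (hsym : ∀ i j a b, i ≠ j → κ i j a b = κ j i b a)
    (h1 : ∀ i j j' a b b', i ≠ j → i ≠ j' → a ≠ 0 → b ≠ 0 → b' ≠ 0 →
      κ i j a b = κ i j' a b' → j = j' ∧ b = b')
    (h2 : ∀ i j a b a' b', i ≠ j → a ≠ 0 → b ≠ 0 → a' ≠ 0 → b' ≠ 0 →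
      κ i j a b = κ i j a' b' → a = a' ∧ b = b') : IsOF n g := by
  classical
  have wt : ∀ x : Fin n → Fin (g + 1), wordWeight x = 2 →
      ∃ i j, i ≠ j ∧ x i ≠ 0 ∧ x j ≠ 0 ∧ ∀ k, x k ≠ 0 → k = i ∨ k = j := by
    intro x hx
    unfold wordWeight at hx
    obtain ⟨i, j, hij, h⟩ := Finset.card_eq_two.1 hx
    have hm : ∀ k, x k ≠ 0 ↔ k = i ∨ k = j := by
      intro k
      have := congrArg (k ∈ ·) h
      simp only [Finset.mem_filter, Finset.mem_univ, true_and, Finset.mem_insert,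
        Finset.mem_singleton, eq_iff_iff] at this
      rw [← this, Ne, Fin.ext_iff]; rfl
    exact ⟨i, j, hij, (hm i).2 (Or.inl rfl), (hm j).2 (Or.inr rfl), fun k => (hm k).1⟩
  obtain ⟨Q, memQ⟩ : ∃ Q : C → Finset (Fin n → Fin (g + 1)), ∀ c x, x ∈ Q c ↔ (wordWeight x = 2 ∧
      ∀ i j, i ≠ j → x i ≠ 0 → x j ≠ 0 → κ i j (x i) (x j) = c) :=
    ⟨fun c => univ.filter (fun x => wordWeight x = 2 ∧
      ∀ i j, i ≠ j → x i ≠ 0 → x j ≠ 0 → κ i j (x i) (x j) = c), by intro c x; simp⟩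
  -- words determined by their support
  have wext : ∀ x y : Fin n → Fin (g + 1), wordWeight x = 2 → wordWeight y = 2 →
      ∀ i j, i ≠ j → x i ≠ 0 → x j ≠ 0 → y i = x i → y j = x j → x = y := by
    intro x y hx hy i j hij hi hj hyi hyj
    obtain ⟨p, q, hpq, hp, hq, hs⟩ := wt x hx
    obtain ⟨p', q', hpq', hp', hq', hs'⟩ := wt y hy
    funext k
    by_cases hki : k = i
    · rw [hki, hyi]
    by_cases hkj : k = j
    · rw [hkj, hyj]
    have e1 : x k = 0 := by
      by_contra h
      have := hs k h; have := hs i hi; have := hs j hj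
      grind
    have e2 : y k = 0 := by
      by_contra h
      have := hs' k h; have := hs' i (by rwa [hyi]); have := hs' j (by rwa [hyj])
      grind
    rw [e1, e2]
  have huniq : ∀ c x y, x ∈ Q c → y ∈ Q c → ∀ i, x i ≠ 0 → y i = x i → x = y := by
    intro c x y hx hy i hi hyi
    rw [memQ] at hx hy
    have other : ∀ x : Fin n → Fin (g + 1), wordWeight x = 2 → x i ≠ 0 → ∃ j, i ≠ j ∧ x j ≠ 0 := by
      intro x hx hi
      obtain ⟨p, q, hpq, hp, hq, hs⟩ := wt x hx
      rcases hs i hi with h | h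
      · exact ⟨q, h ▸ hpq, hq⟩
      · exact ⟨p, h ▸ hpq.symm, hp⟩
    obtain ⟨j, hij, hj⟩ := other x hx.1 hi
    obtain ⟨j', hij', hj'⟩ := other y hy.1 (by rwa [hyi])
    have ex := hx.2 i j hij hi hj
    have ey := hy.2 i j' hij' (by rwa [hyi]) hj'
    rw [hyi] at ey
    obtain ⟨e1, e2⟩ := h1 i j j' (x i) (x j) (y j') hij hij' hi hj hj' (ex.trans ey.symm)
    subst e1
    exact wext x y hx.1 hy.1 i j hij hi hj hyi e2.symm
  -- existence
  have hex : ∀ c i a, a ≠ 0 → ∃ x ∈ Q c, x i = a := by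
    intro c i a ha
    let S := {j : Fin n // j ≠ i} × {b : Fin (g + 1) // b ≠ 0}
    let f : S → C := fun p => κ i p.1 a p.2
    have finj : Function.Injective f := by
      rintro ⟨⟨j, hj⟩, ⟨b, hb⟩⟩ ⟨⟨j', hj'⟩, ⟨b', hb'⟩⟩ h
      obtain ⟨rfl, rfl⟩ := h1 i j j' a b b' hj.symm hj'.symm ha hb hb' h
      rfl
    have hcard : Fintype.card S = Fintype.card C := by
      rw [hC, Fintype.card_prod, Fintype.card_subtype_compl, Fintype.card_subtype_compl]
      simp [mul_comm]
    obtain ⟨⟨⟨j, hj⟩, ⟨b, hb⟩⟩, hc⟩ := ((Fintype.bijective_iff_injective_and_card f).2 ⟨finj, hcard⟩).2 c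
    have hc : κ i j a b = c := hc
    let x : Fin n → Fin (g + 1) := fun k => if k = i then a else if k = j then b else 0
    have xi : x i = a := by simp [x]
    have xj : x j = b := by simp [x, hj]
    have xs : ∀ k, x k ≠ 0 → k = i ∨ k = j := by
      intro k hk; by_contra h; push Not at h; simp [x, h.1, h.2] at hk
    refine ⟨x, (memQ _ _).2 ⟨?_, ?_⟩, xi⟩
    · unfold wordWeight
      rw [Finset.card_eq_two]
      refine ⟨i, j, hj.symm, ?_⟩
      ext k
      simp only [Finset.mem_filter, Finset.mem_univ, true_and, Finset.mem_insert,
        Finset.mem_singleton]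
      constructor
      · intro h; exact xs k (fun h' => h (by rw [h']; rfl))
      · rintro (rfl | rfl)
        · rw [xi]; exact fun h => ha (Fin.ext h)
        · rw [xj]; exact fun h => hb (Fin.ext h)
    · intro p q hpq hp hq
      rcases xs p hp with rfl | rfl <;> rcases xs q hq with rfl | rfl
      · exact absurd rfl hpq
      · rw [xi, xj, hc]
      · rw [xi, xj, hsym _ _ _ _ hpq, hc]
      · exact absurd rfl hpq
  have hQcard : ∀ c, (Q c).card = g * n / 2 := by
    intro c
    have e1 : ∑ x ∈ Q c, (univ.filter (fun i => x i ≠ 0)).card = (Q c).card * 2 := by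
      rw [Finset.sum_const_nat]
      intro x hx
      have := ((memQ c x).1 hx).1
      unfold wordWeight at this
      rw [← this]
      congr 1
      apply Finset.filter_congr
      intro k _
      exact not_congr Fin.ext_iff
    have e2 : ∑ x ∈ Q c, (univ.filter (fun i => x i ≠ 0)).card
        = ∑ i : Fin n, ((Q c).filter (fun x => x i ≠ 0)).card := by
      simp only [Finset.card_filter]
      exact Finset.sum_comm
    have e3 : ∀ i : Fin n, ((Q c).filter (fun x => x i ≠ 0)).card = g := by
      intro i
      have : ((Q c).filter (fun x => x i ≠ 0)).card
          = (univ.filter (fun a : Fin (g + 1) => a ≠ 0)).card := by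
        apply Finset.card_bij (fun x _ => x i)
        · intro x hx; simpa using (Finset.mem_filter.1 hx).2
        · intro x hx y hy h
          rw [Finset.mem_filter] at hx hy
          exact huniq c x y hx.1 hy.1 i hx.2 h.symm
        · intro a ha
          have ha : a ≠ 0 := by simpa using ha
          obtain ⟨x, hx, hxi⟩ := hex c i a ha
          exact ⟨x, Finset.mem_filter.2 ⟨hx, by rwa [hxi]⟩, hxi⟩
      rw [this]
      simp [Finset.filter_ne']
    rw [e1] at e2
    simp only [e3] at e2
    simp at e2
    rw [mul_comm g n]
    omega
  have e : Fin (g * (n - 1)) ≃ C := (Fintype.equivFinOfCardEq hC).symm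
  refine ⟨fun k => Q (e k), ?_, ?_, fun k => hQcard _, ?_⟩
  · intro k l hkl
    rw [Finset.disjoint_left]
    intro x hx hy
    rw [memQ] at hx hy
    obtain ⟨i, j, hij, hi, hj, -⟩ := wt x hx.1
    exact hkl (e.injective ((hx.2 i j hij hi hj).symm.trans (hy.2 i j hij hi hj)))
  · ext x
    simp only [Finset.mem_biUnion, Finset.mem_univ, true_and, weightTwoWords, Finset.mem_filter]
    constructor
    · rintro ⟨k, hk⟩; exact ((memQ _ _).1 hk).1
    · intro hx
      obtain ⟨i, j, hij, hi, hj, hs⟩ := wt x hx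
      refine ⟨e.symm (κ i j (x i) (x j)), (memQ _ _).2 ⟨hx, ?_⟩⟩
      intro p q hpq hp hq
      rw [Equiv.apply_symm_apply]
      rcases hs p hp with rfl | rfl <;> rcases hs q hq with rfl | rfl
      · exact absurd rfl hpq
      · rfl
      · exact hsym _ _ _ _ hpq
      · exact absurd rfl hpq
  · intro k x hx y hy hxy
    have hu := huniq _ x y hx hy
    have hx' := (memQ _ _).1 hx
    have hy' := (memQ _ _).1 hy
    obtain ⟨i, j, hij, hi, hj, hs⟩ := wt x hx'.1
    obtain ⟨p, q, hpq, hp, hq, hs'⟩ := wt y hy'.1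
    have di : y i ≠ x i := fun h => hxy (hu i hi h)
    have dj : y j ≠ x j := fun h => hxy (hu j hj h)
    have hex : ∃ l, l ≠ i ∧ l ≠ j ∧ y l ≠ 0 := by
      by_contra hcon
      push Not at hcon
      have hp2 : p = i ∨ p = j := by
        by_contra h; push Not at h; exact hp (hcon p h.1 h.2)
      have hq2 : q = i ∨ q = j := by
        by_contra h; push Not at h; exact hq (hcon q h.1 h.2)
      have hyi : y i ≠ 0 := by grind
      have hyj : y j ≠ 0 := by grind
      have := h2 i j _ _ _ _ hij hi hj hyi hyj
        ((hx'.2 i j hij hi hj).trans (hy'.2 i j hij hyi hyj).symm)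
      exact di this.1.symm
    obtain ⟨l, hli, hlj, hl⟩ := hex
    have hxl : x l = 0 := by
      by_contra h; rcases hs l h with h | h
      · exact hli h
      · exact hlj h
    have hsub : ({i, j, l} : Finset (Fin n)) ⊆ univ.filter (fun k => x k ≠ y k) := by
      intro k hk
      simp only [Finset.mem_insert, Finset.mem_singleton] at hk
      rw [Finset.mem_filter]
      refine ⟨Finset.mem_univ _, ?_⟩
      rcases hk with rfl | rfl | rfl
      · exact di.symm
      · exact dj.symm
      · rw [hxl]; exact hl.symm
    have hc3 : ({i, j, l} : Finset (Fin n)).card = 3 :=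
      Finset.card_eq_three.2 ⟨i, j, l, hij, hli.symm, hlj.symm, rfl⟩
    calc 3 = _ := hc3.symm
      _ ≤ _ := Finset.card_le_card hsub

/-- A family of disjoint unipotent Latin squares, closed under transposition. -/
def GoodFamily (g : ℕ) (I C : Type) : Prop :=
  ∃ L : ZMod g → I → I → C,
    (∀ t i j, i ≠ j → L (-t) i j = L t j i) ∧
    (∀ t i j j', i ≠ j → i ≠ j' → L t i j = L t i j' → j = j') ∧
    (∀ t t' i j, i ≠ j → L t i j = L t' i j → t = t')

theorem isOF_of_goodFamily {n g : ℕ} (hg : Odd g) {I C : Type} [Fintype I] [Fintype C]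
    (hI : Fintype.card I = n) (hC : Fintype.card C = n - 1)
    (h : GoodFamily g I C) : IsOF n g := by
  classical
  obtain ⟨L, h1, h2, h3⟩ := h
  have : NeZero g := ⟨hg.pos.ne'⟩
  have two : ∀ a b : ZMod g, a + a = b + b → a = b := by
    intro a b hab
    have hu : IsUnit ((2 : ℕ) : ZMod g) := (ZMod.isUnit_iff_coprime 2 g).2 (by
      simpa using hg)
    apply hu.mul_left_cancel
    push_cast
    rw [two_mul, two_mul, hab]
  let e : Fin n ≃ I := (Fintype.equivFinOfCardEq hI).symm
  let v : Fin (g + 1) → ZMod g := fun a => ((a : ℕ) : ZMod g)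
  have vinj : ∀ a b : Fin (g + 1), a ≠ 0 → b ≠ 0 → v a = v b → a = b := by
    intro a b ha hb hab
    have ha' : (a : ℕ) ≠ 0 := fun h => ha (Fin.ext h)
    have hb' : (b : ℕ) ≠ 0 := fun h => hb (Fin.ext h)
    have hm := (ZMod.natCast_eq_natCast_iff' _ _ _).1 hab
    have := a.2
    have := b.2
    apply Fin.ext
    rcases Nat.lt_or_ge (a : ℕ) g with h | h <;> rcases Nat.lt_or_ge (b : ℕ) g with h' | h'
    · rwa [Nat.mod_eq_of_lt h, Nat.mod_eq_of_lt h'] at hm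
    · have : (b : ℕ) = g := by omega
      rw [Nat.mod_eq_of_lt h, this, Nat.mod_self] at hm; omega
    · have : (a : ℕ) = g := by omega
      rw [Nat.mod_eq_of_lt h', this, Nat.mod_self] at hm; omega
    · omega
  apply isOF_of_kappa (C := ZMod g × C) (by simp [ZMod.card, hC])
    (fun i j a b => (v a + v b, L (v a - v b) (e i) (e j)))
  · intro i j a b hij
    have := h1 (v b - v a) (e i) (e j) (by simpa using hij)
    rw [neg_sub] at this
    rw [Prod.mk.injEq]
    exact ⟨add_comm _ _, this⟩
  · intro i j j' a b b' hij hij' ha hb hb' h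
    rw [Prod.mk.injEq] at h
    have hbb := vinj b b' hb hb' (add_left_cancel h.1)
    subst hbb
    exact ⟨e.injective (h2 _ _ _ _ (by simpa using hij) (by simpa using hij') h.2), rfl⟩
  · intro i j a b a' b' hij ha hb ha' hb' h
    rw [Prod.mk.injEq] at h
    have hd := h3 _ _ _ _ (by simpa using hij) h.2
    have haa := two (v a) (v a') (by linear_combination h.1 + hd)
    have hbb := two (v b) (v b') (by linear_combination h.1 - hd)
    exact ⟨vinj _ _ ha ha' haa, vinj _ _ hb hb' hbb⟩
/-- Absolute value label. -/
def kLab (N m : ℕ) (d : ZMod N) : ZMod m := ((d.valMinAbs.natAbs : ℕ) : ZMod m)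
/-- Sign label. -/
def sLab (N : ℕ) (d : ZMod N) : Bool := decide (0 < d.valMinAbs)

theorem kLab_neg (N m : ℕ) (d : ZMod N) : kLab N m (-d) = kLab N m d := by
  unfold kLab; rw [ZMod.natAbs_valMinAbs_neg]

theorem kLab_zero (N m : ℕ) : kLab N m 0 = 0 := by
  unfold kLab; simp

theorem sLab_zero (N : ℕ) : sLab N 0 = false := by
  unfold sLab; simp

theorem sLab_neg (N : ℕ) (d : ZMod N) (hd : d ≠ 0) (h : 2 * d.val ≠ N) :
    sLab N (-d) = !sLab N d := by
  unfold sLab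
  rw [ZMod.valMinAbs_neg_of_ne_half h]
  have : d.valMinAbs ≠ 0 := by rwa [Ne, ZMod.valMinAbs_eq_zero]
  rw [← decide_not, decide_eq_decide]
  omega

theorem sLab_neg_odd (N : ℕ) (hN : Odd N) (d : ZMod N) (hd : d ≠ 0) :
    sLab N (-d) = !sLab N d :=
  sLab_neg N d hd (by obtain ⟨k, hk⟩ := hN; omega)

theorem lab_eq (N : ℕ) [NeZero N] (d d' : ZMod N)
    (h : d.valMinAbs.natAbs = d'.valMinAbs.natAbs) (hs : sLab N d = sLab N d') : d = d' := by
  unfold sLab at hs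
  rw [decide_eq_decide] at hs
  apply ZMod.injective_valMinAbs
  omega

theorem lab_inj (N m : ℕ) [NeZero N] (h : N ≤ 2 * m + 1) (d d' : ZMod N)
    (hd : d ≠ 0) (hd' : d' ≠ 0) (hk : kLab N m d = kLab N m d') (hs : sLab N d = sLab N d') :
    d = d' := by
  have a1 := ZMod.natAbs_valMinAbs_le d
  have a2 := ZMod.natAbs_valMinAbs_le d'
  have b1 : d.valMinAbs ≠ 0 := by rwa [Ne, ZMod.valMinAbs_eq_zero]
  have b2 : d'.valMinAbs ≠ 0 := by rwa [Ne, ZMod.valMinAbs_eq_zero]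
  apply lab_eq N d d' _ hs
  unfold kLab at hk
  have hm := (ZMod.natCast_eq_natCast_iff' _ _ _).1 hk
  have c1 : d.valMinAbs.natAbs ≠ 0 := by omega
  have c2 : d'.valMinAbs.natAbs ≠ 0 := by omega
  have d1 : d.valMinAbs.natAbs ≤ m := by omega
  have d2 : d'.valMinAbs.natAbs ≤ m := by omega
  generalize d.valMinAbs.natAbs = x at hm c1 d1 ⊢
  generalize d'.valMinAbs.natAbs = y at hm c2 d2 ⊢
  rcases d1.lt_or_eq with h | h <;> rcases d2.lt_or_eq with h' | h'
  · rwa [Nat.mod_eq_of_lt h, Nat.mod_eq_of_lt h'] at hm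
  · rw [Nat.mod_eq_of_lt h, h', Nat.mod_self] at hm; omega
  · rw [Nat.mod_eq_of_lt h', h, Nat.mod_self] at hm; omega
  · omega

theorem kLab_ne_zero (N m : ℕ) [NeZero N] (h : N ≤ 2 * m) (d : ZMod N)
    (hd : d ≠ 0) (hd' : 2 * d.val ≠ N) : kLab N m d ≠ 0 := by
  have b1 : d.valMinAbs ≠ 0 := by rwa [Ne, ZMod.valMinAbs_eq_zero]
  have h3 := ZMod.valMinAbs_def_pos d
  have h4 := d.val_lt
  unfold kLab
  rw [Ne, ZMod.natCast_eq_zero_iff]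
  intro hdvd
  have h5 := Nat.le_of_dvd (by omega) hdvd
  split_ifs at h3 <;> omega
theorem val_cast_inj (g r : ℕ) [NeZero g] (h : g ≤ r) (t t' : ZMod g)
    (hh : ((t.val : ℕ) : ZMod r) = ((t'.val : ℕ) : ZMod r)) : t = t' := by
  have hm := (ZMod.natCast_eq_natCast_iff' _ _ _).1 hh
  have a1 := t.val_lt
  have a2 := t'.val_lt
  rw [Nat.mod_eq_of_lt (by omega), Nat.mod_eq_of_lt (by omega)] at hm
  exact ZMod.val_injective g hm

theorem core_odd {T R K : Type} [AddCommGroup T] [AddCommGroup R] [AddCommGroup K]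
    [DecidableEq T] [DecidableEq R] (X : Bool → Bool → Bool)
    (X1 : ∀ a b, X (!a) (!b) = X a b) (X2 : ∀ a b c, X a c = X b c → a = b)
    (X3 : ∀ a b c, X a b = X a c → b = c)
    (k : R → K) (s : R → Bool) (A : T → K) (σ : T → Bool) (u : T → R)
    (k_neg : ∀ d, k (-d) = k d) (A_neg : ∀ d, A (-d) = A d)
    (s_neg : ∀ d, d ≠ 0 → s (-d) = !s d) (σ_neg : ∀ d, d ≠ 0 → σ (-d) = !σ d)
    (ks : ∀ d d', d ≠ 0 → d' ≠ 0 → k d = k d' → s d = s d' → d = d')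
    (Aσ : ∀ d d', d ≠ 0 → d' ≠ 0 → A d = A d' → σ d = σ d' → d = d')
    (u_inj : ∀ t t', u t = u t' → t = t') (u_zero : u 0 = 0) :
  ∃ L : T → R × Bool → R × Bool → (K × Bool) ⊕ R,
    (∀ t i j, i ≠ j → L (-t) i j = L t j i) ∧
    (∀ t i j j', i ≠ j → i ≠ j' → L t i j = L t i j' → j = j') ∧
    (∀ t t' i j, i ≠ j → L t i j = L t' i j → t = t') := by
  refine ⟨fun t i j =>
    if t = 0 then
      (if i.2 = j.2 then Sum.inr (i.1 + j.1)
       else if i.1 = j.1 then Sum.inr (i.1 + j.1)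
       else if i.2 then Sum.inl (k (i.1 - j.1), s (i.1 - j.1))
       else Sum.inl (k (j.1 - i.1), s (j.1 - i.1)))
    else
      (if i.2 = j.2 then Sum.inl (k (j.1 - i.1) + A t, X (s (j.1 - i.1)) (σ t))
       else Sum.inr (i.1 + j.1 + u (if i.2 then t else -t))), ?_, ?_, ?_⟩
  · rintro t ⟨x, e⟩ ⟨y, f⟩ hij
    have hk := k_neg (x - y)
    have hs := s_neg (x - y)
    rw [neg_sub, sub_ne_zero] at hs
    rw [neg_sub] at hk
    have hσ := σ_neg t
    have hA := A_neg t
    have hX := X1 (s (x - y)) (σ t)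
    by_cases ht : t = 0
    · subst ht
      cases e <;> cases f <;> simp [add_comm, eq_comm]
    · clear k_neg s_neg σ_neg A_neg X1 X2 X3 ks Aσ u_inj
      cases e <;> cases f <;> simp [ht, add_comm] at hij ⊢ <;> grind
  · rintro t ⟨x, e⟩ ⟨y, f⟩ ⟨z, f'⟩ hij hij' h
    have h1 := ks (y - x) (z - x)
    have h2 := ks (x - y) (x - z)
    rw [sub_ne_zero, sub_ne_zero, sub_left_inj] at h1
    rw [sub_ne_zero, sub_ne_zero, sub_right_inj] at h2
    have hX := X2 (s (y - x)) (s (z - x)) (σ t)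
    clear k_neg s_neg σ_neg A_neg X1 X2 X3 ks Aσ u_inj
    by_cases ht : t = 0
    · subst ht
      cases e <;> cases f <;> cases f' <;> simp at hij hij' h ⊢ <;> grind
    · cases e <;> cases f <;> cases f' <;> simp [ht] at hij hij' h ⊢ <;> grind
  · rintro t t' ⟨x, e⟩ ⟨y, f⟩ hij h
    have hu := u_inj t t'
    have hu0 := u_inj t 0
    have hu0' := u_inj t' 0
    have hun := u_inj (-t) (-t')
    have hun0 := u_inj (-t) 0
    have hun0' := u_inj (-t') 0
    rw [neg_inj] at hun
    rw [neg_eq_zero] at hun0 hun0'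
    have hAσ := Aσ t t'
    have hX := X3 (s (y - x)) (σ t) (σ t')
    clear k_neg s_neg σ_neg A_neg X1 X2 X3 ks Aσ u_inj
    by_cases ht : t = 0 <;> by_cases ht' : t' = 0
    · rw [ht, ht']
    all_goals cases e <;> cases f <;> simp [ht, ht'] at hij h ⊢ <;> grind

theorem goodFamily_odd (g r m : ℕ) (hr : r = 2 * m + 1) (hg : Odd g) (hgr : g ≤ r) :
    GoodFamily g (ZMod r × Bool) ((ZMod m × Bool) ⊕ ZMod r) := by
  have : NeZero g := ⟨hg.pos.ne'⟩
  have : NeZero r := ⟨by omega⟩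
  have rodd : Odd r := ⟨m, hr⟩
  exact core_odd xor (by decide) (by decide) (by decide) (kLab r m) (sLab r) (kLab g m) (sLab g)
    (fun t => ((t.val : ℕ) : ZMod r)) (kLab_neg r m) (kLab_neg g m) (sLab_neg_odd r rodd)
    (sLab_neg_odd g hg) (lab_inj r m (by omega)) (lab_inj g m (by omega))
    (val_cast_inj g r hgr) (by simp)

set_option maxHeartbeats 1600000 in
theorem core_even {T R K V : Type} [AddCommGroup T] [AddCommGroup R] [AddCommGroup K]
    [AddCommGroup V] [DecidableEq T] [DecidableEq R] (X : Bool → Bool → Bool)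
    (X1 : ∀ a b, X (!a) (!b) = X a b) (X2 : ∀ a b c, X a c = X b c → a = b)
    (X3 : ∀ a b c, X a b = X a c → b = c)
    (η : R) (hη2 : -η = η)
    (k : R → K) (s : R → Bool) (A : T → K) (σ : T → Bool) (u : T → V) (v : R → V)
    (z : R → Bool → Bool) (ρ : R → R → V)
    (k_neg : ∀ d, k (-d) = k d) (A_neg : ∀ d, A (-d) = A d)
    (k_zero : k 0 = 0) (k_half : k η = 0) (k_ne : ∀ d, d ≠ 0 → d ≠ η → k d ≠ 0)
    (A_ne : ∀ d, d ≠ 0 → A d ≠ 0)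
    (s_neg : ∀ d, d ≠ 0 → d ≠ η → s (-d) = !s d) (σ_neg : ∀ d, d ≠ 0 → σ (-d) = !σ d)
    (ks : ∀ d d', k d = k d' → s d = s d' → d = d')
    (Aσ : ∀ d d', d ≠ 0 → d' ≠ 0 → A d = A d' → σ d = σ d' → d = d')
    (u_inj : ∀ t t', u t = u t' → t = t')
    (v_inj : ∀ d d', d ≠ 0 → d' ≠ 0 → v d = v d' → d = d')
    (z1 : ∀ x e, z (x + η) e = !z x e) (z2 : ∀ x e, z x (!e) = !z x e)
    (ρ_symm : ∀ x y, ρ x y = ρ y x)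
    (ρ_inj : ∀ x y y', x ≠ y → x ≠ y' → ρ x y = ρ x y' → y = y') :
  ∃ L : T → R × Bool → R × Bool → (K × Bool) ⊕ V,
    (∀ t i j, i ≠ j → L (-t) i j = L t j i) ∧
    (∀ t i j j', i ≠ j → i ≠ j' → L t i j = L t i j' → j = j') ∧
    (∀ t t' i j, i ≠ j → L t i j = L t' i j → t = t') := by
  refine ⟨fun t i j =>
    if t = 0 then
      (if i.2 = j.2 then Sum.inr (ρ i.1 j.1)
       else if i.2 then Sum.inl (k (i.1 - j.1), s (i.1 - j.1))
       else Sum.inl (k (j.1 - i.1), s (j.1 - i.1)))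
    else
      (if i.2 = j.2 then
        (if j.1 - i.1 = η then Sum.inl (A t, X (z i.1 i.2) (σ t))
         else Sum.inl (k (j.1 - i.1) + A t, X (s (j.1 - i.1)) (σ t)))
       else if i.1 = j.1 then Sum.inl (A t, X (!z i.1 i.2) (σ t))
       else if i.2 then Sum.inr (v (i.1 - j.1) + u t)
       else Sum.inr (v (j.1 - i.1) + u (-t))), ?_, ?_, ?_⟩
  · rintro t ⟨x, e⟩ ⟨y, f⟩ hij
    by_cases ht : t = 0
    · subst ht
      cases e <;> cases f <;> simp [ρ_symm x y]
    have hσ := σ_neg t ht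
    have hA := A_neg t
    by_cases hef : e = f
    · subst hef
      have hxy : x ≠ y := fun h => hij (by rw [h])
      by_cases hd : y - x = η
      · have hd' : x - y = η := by rw [← hη2, ← hd, neg_sub]
        have hx : x = y + η := by rw [← hd']; abel
        have := z1 y e
        rw [← hx] at this
        simp [ht, hd, hd', this, hσ, hA, X1]
      · have hd' : x - y ≠ η := by
          intro h; apply hd; rw [← hη2, ← h, neg_sub]
        have hk := k_neg (x - y)
        have hs := s_neg (x - y) (sub_ne_zero.2 hxy) hd'
        rw [neg_sub] at hk hs
        simp [ht, hd, hd', hk, hs, hσ, hA, X1]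
    · by_cases hxy : x = y
      · subst hxy
        have h1 := z2 x true
        simp only [Bool.not_true] at h1
        have hX := X1 (!z x true) (σ t)
        have hX' := X1 (z x true) (σ t)
        rw [Bool.not_not] at hX
        cases e <;> cases f
        · exact absurd rfl hef
        · simp [ht, h1, hσ, hA, hX]
        · simp [ht, h1, hσ, hA, hX']
        · exact absurd rfl hef
      · have hyx : ¬ y = x := fun h => hxy h.symm
        cases e <;> cases f
        · exact absurd rfl hef
        · simp [ht, hxy, hyx]
        · simp [ht, hxy, hyx]
        · exact absurd rfl hef
  · rintro t ⟨x, e⟩ ⟨y, f⟩ ⟨w, f'⟩ hij hij' h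
    have h1 := ks (y - x) (w - x)
    have h2 := ks (x - y) (x - w)
    have h3 := v_inj (y - x) (w - x)
    have h4 := v_inj (x - y) (x - w)
    have h5 := k_ne (y - x)
    have h6 := k_ne (w - x)
    have h7 := ρ_inj x y w
    have h8 : y - x = w - x → y = w := fun h => sub_left_injective h
    rw [sub_ne_zero] at h5 h6
    rw [sub_ne_zero, sub_ne_zero, sub_left_inj] at h3
    rw [sub_left_inj] at h1
    rw [sub_ne_zero, sub_ne_zero, sub_right_inj] at h4
    rw [sub_right_inj] at h2
    have hX := X2 (s (y - x)) (s (w - x)) (σ t)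
    have hX1 := X2 (z x e) (!z x e) (σ t)
    have hX2 := X2 (!z x e) (z x e) (σ t)
    clear k_neg s_neg σ_neg A_neg X1 X2 X3 ks Aσ u_inj v_inj k_ne A_ne z1 z2 ρ_symm ρ_inj
    by_cases ht : t = 0
    · subst ht
      cases e <;> cases f <;> cases f' <;> simp at hij hij' h ⊢ <;> grind
    · cases e <;> cases f <;> cases f' <;> simp only [ht, if_false, if_true] at hij hij' h ⊢ <;>
      grind
  · rintro t t' ⟨x, e⟩ ⟨y, f⟩ hij h
    have hu := u_inj t t'
    have hun := u_inj (-t) (-t')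
    rw [neg_inj] at hun
    have hAσ := Aσ t t'
    have hX := X3 (s (y - x)) (σ t) (σ t')
    have hX1 := X3 (z x e) (σ t) (σ t')
    have hX2 := X3 (!z x e) (σ t) (σ t')
    have hA := A_ne t
    have hA' := A_ne t'
    have hk1 : x = y → k (x - y) = 0 := by rintro rfl; rw [sub_self, k_zero]
    have hk2 : x = y → k (y - x) = 0 := by rintro rfl; rw [sub_self, k_zero]
    clear k_neg s_neg σ_neg A_neg X1 X2 X3 ks Aσ u_inj v_inj k_ne A_ne z1 z2 ρ_symm ρ_inj
    by_cases ht : t = 0 <;> by_cases ht' : t' = 0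
    · rw [ht, ht']
    all_goals cases e <;> cases f <;> simp only [ht, ht', if_false, if_true] at hij h ⊢ <;> grind

theorem factor_even (N : ℕ) (hN : Odd N) :
    ∃ ρ : ZMod (N + 1) → ZMod (N + 1) → ZMod N, (∀ x y, ρ x y = ρ y x) ∧
      (∀ x y y', x ≠ y → x ≠ y' → ρ x y = ρ x y' → y = y') := by
  have : NeZero N := ⟨hN.pos.ne'⟩
  have two : ∀ a b : ZMod N, a + a = b + b → a = b := by
    intro a b hab
    have hu : IsUnit ((2 : ℕ) : ZMod N) := (ZMod.isUnit_iff_coprime 2 N).2 (by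
      simpa using hN)
    apply hu.mul_left_cancel
    push_cast
    rw [two_mul, two_mul, hab]
  obtain ⟨c, hc⟩ : ∃ c : ZMod (N + 1) → ZMod N, c = fun x => ((x.val : ℕ) : ZMod N) := ⟨_, rfl⟩
  have cinj : ∀ x y : ZMod (N + 1), x.val ≠ N → y.val ≠ N → c x = c y → x = y := by
    intro x y hx hy h
    rw [hc] at h
    have hm := (ZMod.natCast_eq_natCast_iff' _ _ _).1 h
    have a1 := x.val_lt
    have a2 := y.val_lt
    rw [Nat.mod_eq_of_lt (by omega), Nat.mod_eq_of_lt (by omega)] at hm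
    exact ZMod.val_injective _ hm
  have vinj : ∀ x y : ZMod (N + 1), x.val = N → y.val = N → x = y := by
    intro x y hx hy
    exact ZMod.val_injective _ (hx.trans hy.symm)
  refine ⟨fun x y => if x.val = N then c y + c y else if y.val = N then c x + c x else c x + c y,
    ?_, ?_⟩
  · intro x y
    by_cases hx : x.val = N <;> by_cases hy : y.val = N
    · rw [vinj x y hx hy]
    all_goals simp [hx, hy, add_comm]
  · intro x y y' h h' e
    have v1 := vinj x y
    have v2 := vinj x y'
    have v3 := vinj y y'
    have c1 := cinj x y
    have c2 := cinj x y'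
    have c3 := cinj y y'
    have t1 := two (c y) (c y')
    by_cases hx : x.val = N <;> by_cases hy : y.val = N <;> by_cases hy' : y'.val = N <;>
      simp [hx, hy, hy'] at v1 v2 v3 c1 c2 c3 t1 e ⊢ <;> grind

theorem goodFamily_even (g r m : ℕ) (hm : 0 < m) (hr : r = 2 * m) (hg : Odd g) (hgr : g ≤ r) :
    GoodFamily g (ZMod r × Bool) ((ZMod m × Bool) ⊕ ZMod (r - 1)) := by
  have : NeZero g := ⟨hg.pos.ne'⟩
  have : NeZero r := ⟨by omega⟩
  have hg2 : g ≠ 2 * m := by obtain ⟨k, hk⟩ := hg; omega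
  have η_val : ((m : ℕ) : ZMod r).val = m := ZMod.val_natCast_of_lt (by omega)
  have η_iff : ∀ d : ZMod r, d ≠ ((m : ℕ) : ZMod r) → 2 * d.val ≠ r := by
    intro d hd h
    apply hd
    apply ZMod.val_injective
    omega
  have ηη : ((m : ℕ) : ZMod r) + ((m : ℕ) : ZMod r) = 0 := by
    rw [← Nat.cast_add, ← two_mul, ← hr, ZMod.natCast_self]
  have η_ne : ((m : ℕ) : ZMod r) ≠ 0 := by
    intro h
    rw [h, ZMod.val_zero] at η_val
    omega
  have η_abs : ((m : ℕ) : ZMod r).valMinAbs = m := by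
    rw [ZMod.valMinAbs_def_pos, if_pos (by omega), η_val]
  have k_half : kLab r m ((m : ℕ) : ZMod r) = 0 := by
    unfold kLab
    rw [η_abs]; simp
  have s_half : sLab r ((m : ℕ) : ZMod r) = true := by
    unfold sLab
    rw [η_abs]; simpa using hm
  have k_ne : ∀ d : ZMod r, d ≠ 0 → d ≠ ((m : ℕ) : ZMod r) → kLab r m d ≠ 0 :=
    fun d h0 h1 => kLab_ne_zero r m (by omega) d h0 (η_iff d h1)
  obtain ⟨ρ, ρ1, ρ2⟩ : ∃ ρ : ZMod r → ZMod r → ZMod (r - 1), (∀ x y, ρ x y = ρ y x) ∧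
      (∀ x y y', x ≠ y → x ≠ y' → ρ x y = ρ x y' → y = y') := by
    obtain ⟨N, rfl⟩ : ∃ N, r = N + 1 := ⟨r - 1, by omega⟩
    exact factor_even N ⟨m - 1, by omega⟩
  refine core_even xor (by decide) (by decide) (by decide) ((m : ℕ) : ZMod r)
    (neg_eq_of_add_eq_zero_left ηη) (kLab r m) (sLab r) (kLab g m) (sLab g)
    (fun t => ((t.val : ℕ) : ZMod (r - 1))) (fun d => ((d.val : ℕ) : ZMod (r - 1)))
    (fun x e => xor (decide (x.val < m)) e) ρ
    (kLab_neg r m) (kLab_neg g m) (kLab_zero r m) k_half k_ne ?_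
    (fun d h0 h1 => sLab_neg r d h0 (η_iff d h1))
    (sLab_neg_odd g hg) ?_ (lab_inj g m (by omega))
    (val_cast_inj g (r - 1) (by omega)) ?_ ?_ (fun x e => by simp) ρ1 ρ2
  · intro d hd
    exact kLab_ne_zero g m (by omega) d hd (by obtain ⟨k, hk⟩ := hg; omega)
  · intro d d' hk hs
    by_cases h0 : d = 0 <;> by_cases h0' : d' = 0
    · rw [h0, h0']
    · subst h0
      by_cases h1 : d' = ((m : ℕ) : ZMod r)
      · rw [h1, s_half, sLab_zero] at hs; simp at hs
      · rw [kLab_zero] at hk; exact absurd hk.symm (k_ne d' h0' h1)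
    · subst h0'
      by_cases h1 : d = ((m : ℕ) : ZMod r)
      · rw [h1, s_half, sLab_zero] at hs; simp at hs
      · rw [kLab_zero] at hk; exact absurd hk (k_ne d h0 h1)
    · exact lab_inj r m (by omega) d d' h0 h0' hk hs
  · intro d d' hd hd' h
    have hmm := (ZMod.natCast_eq_natCast_iff' _ _ _).1 h
    have a1 := d.val_lt
    have a2 := d'.val_lt
    have b1 : d.val ≠ 0 := by rwa [Ne, ZMod.val_eq_zero]
    have b2 : d'.val ≠ 0 := by rwa [Ne, ZMod.val_eq_zero]
    apply ZMod.val_injective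
    rcases Nat.lt_or_ge d.val (r - 1) with h | h <;> rcases Nat.lt_or_ge d'.val (r - 1) with h' | h'
    · rwa [Nat.mod_eq_of_lt h, Nat.mod_eq_of_lt h'] at hmm
    · have : d'.val = r - 1 := by omega
      rw [Nat.mod_eq_of_lt h, this, Nat.mod_self] at hmm; omega
    · have : d.val = r - 1 := by omega
      rw [Nat.mod_eq_of_lt h', this, Nat.mod_self] at hmm; omega
    · omega
  · intro x e
    have a1 := x.val_lt
    have : decide ((x + ((m : ℕ) : ZMod r)).val < m) = !decide (x.val < m) := by
      rw [ZMod.val_add, η_val, ← decide_not, decide_eq_decide]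
      rcases Nat.lt_or_ge (x.val + m) r with h | h
      · rw [Nat.mod_eq_of_lt h]; omega
      · rw [Nat.mod_eq_sub_mod h, Nat.mod_eq_of_lt (by omega)]; omega
    rw [this]; simp

/-- Let `g ≥ 5` be odd and let `n > g` be even such that neither
(`n ≡ 2 (mod 4)` and `n ≤ 2g-4`) nor (`n ≡ 0 (mod 4)` and `n ≤ 4g-4`) holds.
Then an `OF(n,g)` exists. -/
theorem exists_OF_odd_g (n g : ℕ) (hg5 : 5 ≤ g) (hgo : Odd g) (hng : g < n)
    (hne : Even n)
    (h1 : ¬(n % 4 = 2 ∧ n ≤ 2 * g - 4))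
    (h2 : ¬(n % 4 = 0 ∧ n ≤ 4 * g - 4)) : IsOF n g := by
  obtain ⟨r, hr⟩ := hne
  have hgr : g ≤ r := by obtain ⟨h, hh⟩ := hgo; omega
  have : NeZero r := ⟨by omega⟩
  rcases Nat.even_or_odd' r with ⟨m, hm | hm⟩
  · have : NeZero m := ⟨by omega⟩
    have : NeZero (r - 1) := ⟨by omega⟩
    refine isOF_of_goodFamily hgo ?_ ?_ (goodFamily_even g r m (by omega) hm hgo hgr)
    · simp [ZMod.card]; omega
    · simp [ZMod.card]; omega
  · have : NeZero m := ⟨by omega⟩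
    refine isOF_of_goodFamily hgo ?_ ?_ (goodFamily_odd g r m hm hgo hgr)
    · simp [ZMod.card]; omega
    · simp [ZMod.card]; omega
end

section
/- Let g ≥ 3 be an odd prime power and let n > g be an even integer such that neither (n ≡ 2 (mod 4) and g+3 ≤ n ≤ 2g−4) nor (n ≡ 0 (mod 4) and g+3 ≤ n ≤ 4g−4) holds. Then an OF(n,g) exists. -/
/-- A system of good one-factors of the complete multipartite graph with parts `V` and labels `A`. -/
structure OFSys (V A I : Type) (E : I → V → A → V → A → Prop) : Prop where
  symm : ∀ i x a y b, E i x a y b → E i y b x a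
  irr : ∀ i x a y b, E i x a y b → x ≠ y
  cover : ∀ x a y b, x ≠ y → ∃ i, E i x a y b
  coverU : ∀ i j x a y b, E i x a y b → E j x a y b → i = j
  perf : ∀ i x a, ∃ y b, E i x a y b
  uniq : ∀ i x a y b y' b', E i x a y b → E i x a y' b' → y = y' ∧ b = b'
  simple : ∀ i x y a b a' b', E i x a y b → E i x a' y b' → a = a'

theorem OFSys.transport {V A I V' A' I' : Type} {E : I → V → A → V → A → Prop}
    (h : OFSys V A I E) (v : V' ≃ V) (α : A' ≃ A) (ι : I' ≃ I) :
    OFSys V' A' I' (fun i x a y b => E (ι i) (v x) (α a) (v y) (α b)) where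
  symm := fun i x a y b => h.symm _ _ _ _ _
  irr := fun i x a y b H e => h.irr _ _ _ _ _ H (by rw [e])
  cover := fun x a y b H => by
    obtain ⟨i, hi⟩ := h.cover (v x) (α a) (v y) (α b) (by simpa using H)
    exact ⟨ι.symm i, by simpa using hi⟩
  coverU := fun i j x a y b H H' => ι.injective (h.coverU _ _ _ _ _ _ H H')
  perf := fun i x a => by
    obtain ⟨y, b, hi⟩ := h.perf (ι i) (v x) (α a)
    exact ⟨v.symm y, α.symm b, by simpa using hi⟩
  uniq := fun i x a y b y' b' H H' => by
    have := h.uniq _ _ _ _ _ _ _ H H'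
    simpa using this
  simple := fun i x y a b a' b' H H' => α.injective (h.simple _ _ _ _ _ _ _ H H')

theorem weight_two_iff {n g : ℕ} (w : Fin n → Fin (g + 1)) (hw : wordWeight w = 2) :
    ∃ x y : Fin n, ∃ a b : Fin g, x ≠ y ∧ w x = a.succ ∧ w y = b.succ ∧
      ∀ z, z ≠ x → z ≠ y → w z = 0 := by
  unfold wordWeight at hw
  rw [Finset.card_eq_two] at hw
  obtain ⟨x, y, hxy, hs⟩ := hw
  have hx : x ∈ Finset.univ.filter (fun i => (w i : ℕ) ≠ 0) := by rw [hs]; simp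
  have hy : y ∈ Finset.univ.filter (fun i => (w i : ℕ) ≠ 0) := by rw [hs]; simp
  simp only [Finset.mem_filter, Finset.mem_univ, true_and] at hx hy
  have hx' : w x ≠ 0 := fun h => hx (by simp [h])
  have hy' : w y ≠ 0 := fun h => hy (by simp [h])
  refine ⟨x, y, (w x).pred hx', (w y).pred hy', hxy, by simp, by simp, ?_⟩
  intro z hzx hzy
  by_contra hz
  have : z ∈ Finset.univ.filter (fun i => (w i : ℕ) ≠ 0) := by
    simp only [Finset.mem_filter, Finset.mem_univ, true_and]
    intro h; exact hz (Fin.ext h)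
  rw [hs] at this
  simp [hzx, hzy] at this

/-- The word with two nonzero entries. -/
def wd {n g : ℕ} (x : Fin n) (a : Fin g) (y : Fin n) (b : Fin g) : Fin n → Fin (g + 1) :=
  fun z => if z = x then a.succ else if z = y then b.succ else 0

theorem wd_weight {n g : ℕ} (x : Fin n) (a : Fin g) (y : Fin n) (b : Fin g) (h : x ≠ y) :
    wordWeight (wd x a y b) = 2 := by
  unfold wordWeight
  rw [Finset.card_eq_two]
  refine ⟨x, y, h, ?_⟩
  ext z
  simp only [wd, Finset.mem_filter, Finset.mem_univ, true_and, Finset.mem_insert,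
    Finset.mem_singleton]
  by_cases h1 : z = x
  · simp [h1]
  · by_cases h2 : z = y
    · simp [h2, h.symm]
    · simp [h1, h2]

theorem wd_symm {n g : ℕ} (x : Fin n) (a : Fin g) (y : Fin n) (b : Fin g) (h : x ≠ y) :
    wd x a y b = wd y b x a := by
  funext z
  simp only [wd]
  split_ifs <;> simp_all

theorem wd_eq_succ {n g : ℕ} {x : Fin n} {a : Fin g} {y : Fin n} {b : Fin g}
    {z : Fin n} {c : Fin g} (h : wd x a y b z = c.succ) : (z = x ∧ c = a) ∨ (z = y ∧ c = b) := by
  simp only [wd] at h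
  split_ifs at h with h1 h2
  · left; exact ⟨h1, (Fin.succ_injective _ h).symm⟩
  · right; exact ⟨h2, (Fin.succ_injective _ h).symm⟩
  · exact absurd h.symm (Fin.succ_ne_zero c)

theorem exists_wd {n g : ℕ} (w : Fin n → Fin (g + 1)) (hw : wordWeight w = 2) :
    ∃ x y : Fin n, ∃ a b : Fin g, x ≠ y ∧ w = wd x a y b := by
  obtain ⟨x, y, a, b, h, h1, h2, h3⟩ := weight_two_iff w hw
  refine ⟨x, y, a, b, h, ?_⟩
  funext z
  simp only [wd]
  split_ifs with e1 e2
  · rw [e1, h1]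
  · rw [e2, h2]
  · exact h3 z e1 e2

theorem hd_ge {n g : ℕ} (w w' : Fin n → Fin (g + 1)) (x y z : Fin n) (h1 : x ≠ y) (h2 : x ≠ z)
    (h3 : y ≠ z) (hx : w x ≠ w' x) (hy : w y ≠ w' y) (hz : w z ≠ w' z) :
    3 ≤ hammingDist w w' := by
  have : ({x, y, z} : Finset (Fin n)) ⊆ Finset.univ.filter (fun i => w i ≠ w' i) := by
    intro i hi
    simp only [Finset.mem_insert, Finset.mem_singleton] at hi
    rcases hi with rfl | rfl | rfl <;> simp [*]
  have h := Finset.card_le_card this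
  rw [Finset.card_eq_three.mpr ⟨x, y, z, h1, h2, h3, rfl⟩] at h
  exact h

theorem OFSys.isOF_fin {n g : ℕ} {E : Fin (g * (n - 1)) → Fin n → Fin g → Fin n → Fin g → Prop}
    (h : OFSys (Fin n) (Fin g) (Fin (g * (n - 1))) E) : IsOF n g := by
  classical
  have key : ∀ i x a y b x' a' y' b', x' ≠ y' → E i x a y b → wd x a y b = wd x' a' y' b' →
      E i x' a' y' b' := by
    intro i x a y b x' a' y' b' hn hE he
    have hx : wd x a y b x' = a'.succ := by rw [he]; simp [wd]
    have hy : wd x a y b y' = b'.succ := by rw [he]; simp [wd, hn.symm]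
    rcases wd_eq_succ hx with ⟨rfl, rfl⟩ | ⟨rfl, rfl⟩
    · rcases wd_eq_succ hy with ⟨rfl, rfl⟩ | ⟨rfl, rfl⟩
      · exact absurd rfl hn
      · exact hE
    · rcases wd_eq_succ hy with ⟨rfl, rfl⟩ | ⟨rfl, rfl⟩
      · exact h.symm _ _ _ _ _ hE
      · exact absurd rfl hn
  refine ⟨fun i => Finset.univ.filter (fun w => ∃ x a y b, E i x a y b ∧ w = wd x a y b),
    ?_, ?_, ?_, ?_⟩
  · intro i j hij
    rw [Finset.disjoint_left]
    intro w hw hw'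
    simp only [Finset.mem_filter, Finset.mem_univ, true_and] at hw hw'
    obtain ⟨x, a, y, b, hE, rfl⟩ := hw
    obtain ⟨x', a', y', b', hE', he⟩ := hw'
    have := key j x' a' y' b' x a y b (h.irr _ _ _ _ _ hE) hE' he.symm
    exact hij (h.coverU _ _ _ _ _ _ hE this)
  · ext w
    simp only [Finset.mem_biUnion, Finset.mem_filter, Finset.mem_univ, true_and, weightTwoWords]
    constructor
    · rintro ⟨i, x, a, y, b, hE, rfl⟩
      exact wd_weight _ _ _ _ (h.irr _ _ _ _ _ hE)
    · intro hw
      obtain ⟨x, y, a, b, hxy, rfl⟩ := exists_wd w hw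
      obtain ⟨i, hi⟩ := h.cover x a y b hxy
      exact ⟨i, x, a, y, b, hi, rfl⟩
  · intro i
    choose Y B hYB using h.perf i
    set P := Finset.univ.filter (fun w => ∃ x a y b, E i x a y b ∧ w = wd x a y b) with hP
    have hc := Finset.card_eq_sum_card_fiberwise (s := (Finset.univ : Finset (Fin n × Fin g)))
      (t := P) (f := fun p => wd p.1 p.2 (Y p.1 p.2) (B p.1 p.2)) (by
        intro p _
        simp only [hP, Finset.coe_filter, Finset.mem_univ, true_and, Set.mem_ofPred_eq]
        exact ⟨_, _, _, _, hYB _ _, rfl⟩)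
    have hf : ∀ w ∈ P, (Finset.univ.filter
        (fun p : Fin n × Fin g => wd p.1 p.2 (Y p.1 p.2) (B p.1 p.2) = w)).card = 2 := by
      intro w hw
      simp only [hP, Finset.mem_filter, Finset.mem_univ, true_and] at hw
      obtain ⟨x, a, y, b, hE, rfl⟩ := hw
      have hne := h.irr _ _ _ _ _ hE
      rw [Finset.card_eq_two]
      refine ⟨(x, a), (y, b), fun e => hne (congrArg Prod.fst e), ?_⟩
      ext ⟨z, c⟩
      simp only [Finset.mem_filter, Finset.mem_univ, true_and, Finset.mem_insert,
        Finset.mem_singleton, Prod.mk.injEq]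
      constructor
      · intro e
        have : wd x a y b z = c.succ := by rw [← e]; simp [wd]
        exact wd_eq_succ this
      · rintro (⟨rfl, rfl⟩ | ⟨rfl, rfl⟩)
        · obtain ⟨e1, e2⟩ := h.uniq _ _ _ _ _ _ _ hE (hYB z c)
          rw [← e1, ← e2]
        · obtain ⟨e1, e2⟩ := h.uniq _ _ _ _ _ _ _ (h.symm _ _ _ _ _ hE) (hYB z c)
          rw [← e1, ← e2]
          exact wd_symm _ _ _ _ hne.symm
    rw [Finset.sum_congr rfl hf] at hc
    simp only [Finset.card_univ, Fintype.card_prod, Fintype.card_fin, Finset.sum_const,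
      smul_eq_mul] at hc
    change P.card = _
    rw [mul_comm g n]
    omega
  · intro i w hw w' hw' hne
    simp only [Finset.mem_filter, Finset.mem_univ, true_and] at hw hw'
    obtain ⟨x, a, y, b, hE, rfl⟩ := hw
    obtain ⟨x', a', y', b', hE', rfl⟩ := hw'
    have n1 := h.irr _ _ _ _ _ hE
    have n2 := h.irr _ _ _ _ _ hE'
    have aux : ∀ x a y b x' a' y' b', E i x a y b → E i x' a' y' b' →
        wd x a y b ≠ wd x' a' y' b' → x = x' → 3 ≤ hammingDist (wd x a y b) (wd x' a' y' b') := by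
      intro x a y b x' a' y' b' hE hE' hne hx
      subst hx
      have n1 := h.irr _ _ _ _ _ hE
      have n2 := h.irr _ _ _ _ _ hE'
      have ha : a ≠ a' := by
        rintro rfl
        obtain ⟨rfl, rfl⟩ := h.uniq _ _ _ _ _ _ _ hE hE'
        exact hne rfl
      have hy : y ≠ y' := by
        rintro rfl
        exact ha (h.simple _ _ _ _ _ _ _ hE hE')
      refine hd_ge _ _ x y y' n1 n2 hy ?_ ?_ ?_
      · simpa [wd] using ha
      · simp [wd, n1.symm, hy]
      · simp [wd, n2.symm, hy.symm, (Fin.succ_ne_zero _).symm]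
    by_cases c1 : x = x'
    · exact aux _ _ _ _ _ _ _ _ hE hE' hne c1
    by_cases c2 : y = x'
    · rw [wd_symm x a y b n1] at hne ⊢
      exact aux _ _ _ _ _ _ _ _ (h.symm _ _ _ _ _ hE) hE' hne c2
    by_cases c3 : x = y'
    · rw [wd_symm x' a' y' b' n2] at hne ⊢
      exact aux _ _ _ _ _ _ _ _ hE (h.symm _ _ _ _ _ hE') hne c3
    refine hd_ge _ _ x y x' n1 c1 c2 ?_ ?_ ?_
    · simp [wd, c1, c3]
    · by_cases c4 : y = y'
      · rw [wd_symm x a y b n1, wd_symm x' a' y' b' n2] at hne ⊢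
        by_contra hcon
        have hb : b = b' := by simpa [wd, c4] using hcon
        subst c4 hb
        exact c1 (h.uniq _ _ _ _ _ _ _ (h.symm _ _ _ _ _ hE) (h.symm _ _ _ _ _ hE')).1
      · simp [wd, n1.symm, c2, c4]
    · simp [wd, Ne.symm c1, Ne.symm c2, (Fin.succ_ne_zero _).symm]

theorem OFSys.isOF {V A I : Type} [Fintype V] [Fintype A] [Fintype I]
    {E : I → V → A → V → A → Prop} (h : OFSys V A I E) {n g : ℕ}
    (hV : Fintype.card V = n) (hA : Fintype.card A = g) (hI : Fintype.card I = g * (n - 1)) :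
    IsOF n g :=
  (h.transport (Fintype.equivFinOfCardEq hV).symm (Fintype.equivFinOfCardEq hA).symm
    (Fintype.equivFinOfCardEq hI).symm).isOF_fin

/-- A one-factorization of the complete graph on `V` with factors indexed by `M`. -/
structure OneFac (V M : Type) (φ : V → V → M) : Prop where
  symm : ∀ x y, φ x y = φ y x
  ex : ∀ x m, ∃ y, x ≠ y ∧ φ x y = m
  inj : ∀ x y z, x ≠ y → x ≠ z → φ x y = φ x z → y = z

/-- Greedy colouring with `|F| + 1` colours of a union of `|F|` one-factors. -/
theorem greedy {V M F : Type} [Fintype V] [Fintype F] {φ : V → V → M} (h : OneFac V M φ)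
    (σ : F → M) : ∃ κ : V → Option F, ∀ x y s, x ≠ y → φ x y = σ s → κ x ≠ κ y := by
  classical
  have main : ∀ S : Finset V, ∃ κ : V → Option F, ∀ x ∈ S, ∀ y ∈ S, ∀ s, x ≠ y → φ x y = σ s →
      κ x ≠ κ y := by
    intro S
    induction S using Finset.induction_on with
    | empty => exact ⟨fun _ => none, by simp⟩
    | insert v S hv ih =>
      obtain ⟨κ, hκ⟩ := ih
      choose N hN using h.ex v
      obtain ⟨o, ho⟩ : ∃ o : Option F, o ∉ Finset.univ.image (fun s : F => κ (N (σ s))) := by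
        by_contra hcon
        push Not at hcon
        have h1 : (Finset.univ : Finset (Option F)) ⊆
            Finset.univ.image (fun s : F => κ (N (σ s))) := fun o _ => hcon o
        have h2 := (Finset.card_le_card h1).trans Finset.card_image_le
        simp at h2
      have ho' : ∀ y s, v ≠ y → φ v y = σ s → o ≠ κ y := by
        intro y s hy hs e
        apply ho
        rw [Finset.mem_image]
        refine ⟨s, Finset.mem_univ _, ?_⟩
        rw [e, h.inj v (N (σ s)) y (hN _).1 hy ((hN _).2.trans hs.symm)]
      refine ⟨Function.update κ v o, ?_⟩
      intro x hx y hy s hxy hs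
      by_cases hxv : x = v
      · subst hxv
        rw [Function.update_self, Function.update_of_ne hxy.symm]
        exact ho' y s hxy hs
      · by_cases hyv : y = v
        · subst hyv
          rw [Function.update_self, Function.update_of_ne hxy]
          exact (ho' x s hxy.symm (by rw [h.symm]; exact hs)).symm
        · rw [Function.update_of_ne hxv, Function.update_of_ne hyv]
          exact hκ x (Finset.mem_of_mem_insert_of_ne hx hxv) y
            (Finset.mem_of_mem_insert_of_ne hy hyv) s hxy hs
  obtain ⟨κ, hκ⟩ := main Finset.univ
  exact ⟨κ, fun x y => hκ x (Finset.mem_univ _) y (Finset.mem_univ _)⟩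

/-- The linear functional attached to a point of the projective line. -/
def lam {F : Type} [Field F] : Option F → F × F → F
  | none, t => t.2
  | some c, t => t.1 + c * t.2

theorem lam_ex {F : Type} [Field F] (k l : Option F) (h : k ≠ l) (a b : F) :
    ∃ t, a = lam k t ∧ b = lam l t := by
  rcases k with _ | c <;> rcases l with _ | d
  · exact absurd rfl h
  · exact ⟨(b - d * a, a), by simp [lam]⟩
  · exact ⟨(a - c * b, b), by simp [lam]⟩
  · have hcd : c - d ≠ 0 := fun e => h (by rw [sub_eq_zero.mp e])
    refine ⟨(a - c * ((a - b) / (c - d)), (a - b) / (c - d)), ?_, ?_⟩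
    · simp [lam]
    · simp only [lam]
      field_simp
      ring

theorem lam_uniq {F : Type} [Field F] (k l : Option F) (h : k ≠ l) (t u : F × F)
    (h1 : lam k t = lam k u) (h2 : lam l t = lam l u) : t = u := by
  obtain ⟨t1, t2⟩ := t
  obtain ⟨u1, u2⟩ := u
  rcases k with _ | c <;> rcases l with _ | d <;> simp only [lam] at h1 h2
  · exact absurd rfl h
  · subst h1; simpa using h2
  · subst h2; simpa using h1
  · have hcd : c - d ≠ 0 := fun e => h (by rw [sub_eq_zero.mp e])
    have : t2 = u2 := by
      apply mul_left_cancel₀ hcd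
      linear_combination h1 - h2
    subst this
    simpa using h1

/-- The main combination: windows on the `K`-part, translations by `F × F` on the rest. -/
theorem combine {V M F K J : Type} [Fintype V] [Field F] [Fintype F] {φ : V → V → M}
    (h : OneFac V M φ) (σ : K ⊕ (J × F) ≃ M) (w : K → F → K)
    (hw1 : ∀ k, Function.Injective (w k)) (hw2 : ∀ s, Function.Bijective (fun k => w k s))
    (c : V → F) (hc : ∀ x y k, x ≠ y → φ x y = σ (Sum.inl k) → c x ≠ c y) :
    ∃ E, OFSys V F ((K × F) ⊕ (J × (F × F))) E := by
  choose κ hκ using fun j : J => greedy h (fun s : F => σ (Sum.inr (j, s)))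
  refine ⟨fun i x a y b => x ≠ y ∧ ∃ s : F, match i with
    | Sum.inl (k, t) => φ x y = σ (Sum.inl (w k s)) ∧ a = s + c x * t ∧ b = s + c y * t
    | Sum.inr (j, t) => φ x y = σ (Sum.inr (j, s)) ∧ a = s + lam (κ j x) t ∧
        b = s + lam (κ j y) t, ?_, ?_, ?_, ?_, ?_, ?_, ?_⟩
  · rintro (⟨k, t⟩ | ⟨j, t⟩) x a y b ⟨hn, s, h1, h2, h3⟩
    · exact ⟨hn.symm, s, by rw [h.symm]; exact h1, h3, h2⟩
    · exact ⟨hn.symm, s, by rw [h.symm]; exact h1, h3, h2⟩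
  · rintro i x a y b ⟨hn, -⟩
    exact hn
  · intro x a y b hn
    rcases hm : σ.symm (φ x y) with k | ⟨j, s⟩
    · have hm' : φ x y = σ (Sum.inl k) := by rw [← hm]; simp
      have hcc : c x - c y ≠ 0 := sub_ne_zero.mpr (hc x y k hn hm')
      obtain ⟨k', hk'⟩ := (hw2 (a - c x * ((a - b) / (c x - c y)))).2 k
      refine ⟨Sum.inl (k', (a - b) / (c x - c y)), hn, a - c x * ((a - b) / (c x - c y)), ?_, ?_, ?_⟩
      · rw [hm']; simp only at hk'; rw [hk']
      · ring
      · field_simp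
        ring
    · have hm' : φ x y = σ (Sum.inr (j, s)) := by rw [← hm]; simp
      obtain ⟨t, h1, h2⟩ := lam_ex _ _ (hκ j x y s hn hm') (a - s) (b - s)
      exact ⟨Sum.inr (j, t), hn, s, hm', by rw [← h1]; ring, by rw [← h2]; ring⟩
  · rintro (⟨k, t⟩ | ⟨j, t⟩) (⟨k', t'⟩ | ⟨j', t'⟩) x a y b ⟨hn, s, h1, h2, h3⟩ ⟨-, s', h1', h2', h3'⟩
    · have hcc : c x - c y ≠ 0 := sub_ne_zero.mpr (hc x y _ hn h1)
      have ht : t = t' := by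
        apply mul_left_cancel₀ hcc
        linear_combination h3 - h2 + h2' - h3'
      subst ht
      have hs : s = s' := by linear_combination h2' - h2
      subst hs
      have := σ.injective (h1.symm.trans h1')
      have := (hw2 s).1 (Sum.inl_injective this)
      rw [this]
    · have := σ.injective (h1.symm.trans h1')
      simp at this
    · have := σ.injective (h1.symm.trans h1')
      simp at this
    · have := σ.injective (h1.symm.trans h1')
      simp only [Sum.inr.injEq, Prod.mk.injEq] at this
      obtain ⟨rfl, rfl⟩ := this
      rw [lam_uniq _ _ (hκ j x y s hn h1) t t' (by linear_combination h2' - h2)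
        (by linear_combination h3' - h3)]
  · rintro (⟨k, t⟩ | ⟨j, t⟩) x a
    · obtain ⟨y, hn, hy⟩ := h.ex x (σ (Sum.inl (w k (a - c x * t))))
      exact ⟨y, _, hn, a - c x * t, hy, by ring, rfl⟩
    · obtain ⟨y, hn, hy⟩ := h.ex x (σ (Sum.inr (j, a - lam (κ j x) t)))
      exact ⟨y, _, hn, a - lam (κ j x) t, hy, by ring, rfl⟩
  · rintro (⟨k, t⟩ | ⟨j, t⟩) x a y b y' b' ⟨hn, s, h1, h2, h3⟩ ⟨hn', s', h1', h2', h3'⟩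
    · have hs : s = s' := by linear_combination h2' - h2
      subst hs
      have := h.inj _ _ _ hn hn' (h1.trans h1'.symm)
      subst this
      exact ⟨rfl, h3.trans h3'.symm⟩
    · have hs : s = s' := by linear_combination h2' - h2
      subst hs
      have := h.inj _ _ _ hn hn' (h1.trans h1'.symm)
      subst this
      exact ⟨rfl, h3.trans h3'.symm⟩
  · rintro (⟨k, t⟩ | ⟨j, t⟩) x y a b a' b' ⟨hn, s, h1, h2, h3⟩ ⟨hn', s', h1', h2', h3'⟩
    · have := hw1 _ (Sum.inl_injective (σ.injective (h1.symm.trans h1')))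
      subst this
      exact h2.trans h2'.symm
    · have := σ.injective (h1.symm.trans h1')
      simp only [Sum.inr.injEq, Prod.mk.injEq, true_and] at this
      subst this
      exact h2.trans h2'.symm

/-- The special case of `2|F|` parts. -/
theorem twice {F : Type} [Field F] (h2 : (2 : F) ≠ 0) :
    ∃ E, OFSys (F × Bool) F ((F × F) ⊕ (F × {c : F // c ≠ 0})) E := by
  classical
  refine ⟨fun i p a q b => match i with
    | Sum.inl (t, u) =>
      (p.2 = q.2 ∧ p.1 ≠ q.1 ∧ a = (p.1 - t) ^ 2 + (q.1 - t) + u ∧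
        b = (q.1 - t) ^ 2 + (p.1 - t) + u) ∨
      (p.2 ≠ q.2 ∧ p.1 + q.1 = 2 * t ∧ a = (p.1 - t) ^ 2 + (p.1 - t) + u ∧
        b = (q.1 - t) ^ 2 + (q.1 - t) + u)
    | Sum.inr (u, c) =>
      (p.2 = false ∧ q.2 = true ∧ q.1 = p.1 + a - u ∧ b = 2 * a - u + c.1) ∨
      (p.2 = true ∧ q.2 = false ∧ p.1 = q.1 + b - u ∧ a = 2 * b - u + c.1), ?_, ?_, ?_, ?_, ?_, ?_, ?_⟩
  · rintro (⟨t, u⟩ | ⟨u, c⟩) p a q b (⟨e1, e2, e3, e4⟩ | ⟨e1, e2, e3, e4⟩)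
    · exact Or.inl ⟨e1.symm, e2.symm, e4, e3⟩
    · exact Or.inr ⟨e1.symm, by rw [add_comm]; exact e2, e4, e3⟩
    · exact Or.inr ⟨e2, e1, e3, e4⟩
    · exact Or.inl ⟨e2, e1, e3, e4⟩
  · rintro (⟨t, u⟩ | ⟨u, c⟩) p a q b (⟨e1, e2, e3, e4⟩ | ⟨e1, e2, e3, e4⟩) rfl
    · exact e2 rfl
    · exact e1 rfl
    · simp [e1] at e2
    · simp [e1] at e2
  · rintro ⟨x, e⟩ a ⟨y, f⟩ b hn
    by_cases hef : e = f
    · subst hef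
      have hxy : x ≠ y := fun e => hn (by rw [e])
      have hd : x - y ≠ 0 := sub_ne_zero.mpr hxy
      obtain ⟨t, ht⟩ : ∃ t : F, a - b = (x - y) * (x + y - 2 * t - 1) := by
        refine ⟨(x + y - 1 - (a - b) / (x - y)) / 2, ?_⟩
        field_simp
        ring
      refine ⟨Sum.inl (t, a - (x - t) ^ 2 - (y - t)), Or.inl ⟨rfl, hxy, ?_, ?_⟩⟩
      · simp only; ring
      · simp only; linear_combination -ht
    · by_cases hc : b - a + x - y = 0
      · refine ⟨Sum.inl ((x + y) / 2, a - (x - (x + y) / 2) ^ 2 - (x - (x + y) / 2)),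
          Or.inr ⟨hef, ?_, ?_, ?_⟩⟩
        · simp only; field_simp
        · simp only; ring
        · have : b = a - x + y := by linear_combination hc
          subst this
          simp only; field_simp; ring
      · rcases e with _ | _ <;> rcases f with _ | _
        · exact absurd rfl hef
        · exact ⟨Sum.inr (x + a - y, ⟨b - a + x - y, hc⟩), Or.inl ⟨rfl, rfl, by simp only; ring, by
            simp only; ring⟩⟩
        · exact ⟨Sum.inr (y + b - x, ⟨a - b + y - x, fun e => hc (by linear_combination -e)⟩),
            Or.inr ⟨rfl, rfl, by simp only; ring, by simp only; ring⟩⟩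
        · exact absurd rfl hef
  · rintro (⟨t, u⟩ | ⟨u, c⟩) (⟨t', u'⟩ | ⟨u', c'⟩) ⟨x, e⟩ a ⟨y, f⟩ b
      (⟨e1, e2, e3, e4⟩ | ⟨e1, e2, e3, e4⟩) (⟨f1, f2, f3, f4⟩ | ⟨f1, f2, f3, f4⟩) <;>
      simp only at e1 e2 e3 e4 f1 f2 f3 f4
    · have hd : x - y ≠ 0 := sub_ne_zero.mpr e2
      have ht : t = t' := by
        apply mul_left_cancel₀ (mul_ne_zero hd h2)
        linear_combination e3 - f3 - e4 + f4
      subst ht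
      have hu : u = u' := by linear_combination f3 - e3
      rw [hu]
    · exact absurd e1 f1
    · exact absurd f1 e1
    · have ht : t = t' := by
        apply mul_left_cancel₀ h2
        exact e2.symm.trans f2
      subst ht
      have hu : u = u' := by linear_combination f3 - e3
      rw [hu]
    · subst f1 f2; simp at e1
    · subst f1 f2; simp at e1
    · exact absurd (by linear_combination -f4 + f3 + e4 - e3 + (y - x) * (e2)) c'.2
    · exact absurd (by linear_combination f3 - f4 + e3 - e4 + (x - y) * e2) c'.2
    · subst e1 e2; simp at f1
    · exact absurd (by linear_combination f4 - f3 - e4 + e3 + (y - x) * f2) c.2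
    · subst e1 e2; simp at f1
    · exact absurd (by linear_combination f3 - f4 - e4 + e3 + (x - y) * f2) c.2
    · have hu : u = u' := by linear_combination e3 - f3
      subst hu
      have hc : c = c' := Subtype.ext (by linear_combination f4 - e4)
      rw [hc]
    · subst e1; simp at f1
    · subst e1; simp at f1
    · have hu : u = u' := by linear_combination e3 - f3
      subst hu
      have hc : c = c' := Subtype.ext (by linear_combination f4 - e4)
      rw [hc]
  · rintro (⟨t, u⟩ | ⟨u, c⟩) ⟨x, e⟩ a
    · by_cases hc : a = (x - t) ^ 2 + (x - t) + u
      · exact ⟨(2 * t - x, !e), _, Or.inr ⟨by simp, by simp only; ring, hc, rfl⟩⟩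
      · refine ⟨(a - u - (x - t) ^ 2 + t, e), _, Or.inl ⟨rfl, ?_, by simp only; ring, rfl⟩⟩
        intro hx
        simp only at hx
        exact hc (by linear_combination -hx)
    · rcases e with _ | _
      · exact ⟨(_, true), _, Or.inl ⟨rfl, rfl, rfl, rfl⟩⟩
      · refine ⟨(x - (a + u - c.1) / 2 + u, false), (a + u - c.1) / 2, Or.inr ⟨rfl, rfl, ?_, ?_⟩⟩
        · simp only; ring
        · field_simp; ring
  · rintro (⟨t, u⟩ | ⟨u, c⟩) ⟨x, e⟩ a ⟨y, f⟩ b ⟨y', f'⟩ b'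
      (⟨e1, e2, e3, e4⟩ | ⟨e1, e2, e3, e4⟩) (⟨f1, f2, f3, f4⟩ | ⟨f1, f2, f3, f4⟩) <;>
      simp only at e1 e2 e3 e4 f1 f2 f3 f4
    · have hy : y = y' := by linear_combination f3 - e3
      subst e1 f1 hy
      exact ⟨rfl, e4.trans f4.symm⟩
    · exact absurd (by linear_combination e3 - f3) e2
    · exact absurd (by linear_combination f3 - e3) f2
    · have hy : y = y' := by linear_combination e2 - f2
      have hf : f = f' := by
        revert e1 f1; cases e <;> cases f <;> cases f' <;> simp
      subst hf hy
      exact ⟨rfl, e4.trans f4.symm⟩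
    · subst e2 f2 e3 f3 e4 f4
      exact ⟨rfl, rfl⟩
    · subst e1; simp at f1
    · subst e1; simp at f1
    · have hb : b = b' := by
        apply mul_left_cancel₀ h2
        linear_combination f4 - e4
      subst hb e2 f2
      have hy : y = y' := by linear_combination f3 - e3
      subst hy
      exact ⟨rfl, rfl⟩
  · rintro (⟨t, u⟩ | ⟨u, c⟩) ⟨x, e⟩ ⟨y, f⟩ a b a' b'
      (⟨e1, e2, e3, e4⟩ | ⟨e1, e2, e3, e4⟩) (⟨f1, f2, f3, f4⟩ | ⟨f1, f2, f3, f4⟩) <;>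
      simp only at e1 e2 e3 e4 f1 f2 f3 f4
    · exact e3.trans f3.symm
    · exact absurd e1 f1
    · exact absurd f1 e1
    · exact e3.trans f3.symm
    · linear_combination f3 - e3
    · subst e1; simp at f1
    · subst e1; simp at f1
    · have hb : b = b' := by linear_combination f3 - e3
      subst hb
      exact e4.trans f4.symm

theorem windows {K F : Type} [Fintype K] [Fintype F]
    (h : Fintype.card K = 0 ∨ Fintype.card F ≤ Fintype.card K) :
    ∃ w : K → F → K, (∀ k, Function.Injective (w k)) ∧
      (∀ s, Function.Bijective (fun k => w k s)) := by
  by_cases h0 : Fintype.card K = 0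
  · have : IsEmpty K := Fintype.card_eq_zero_iff.mp h0
    exact ⟨fun k _ => k, fun k => isEmptyElim k, fun s => ⟨fun k => isEmptyElim k,
      fun k => isEmptyElim k⟩⟩
  · have h1 : Fintype.card F ≤ Fintype.card K := h.resolve_left h0
    obtain ⟨r, hr⟩ : ∃ r, r = Fintype.card K := ⟨_, rfl⟩
    rw [← hr] at h0 h1
    have : NeZero r := ⟨h0⟩
    have e : K ≃ ZMod r := Fintype.equivOfCardEq (by rw [ZMod.card, hr])
    obtain ⟨ι⟩ : Nonempty (F ↪ ZMod r) :=
      Function.Embedding.nonempty_of_card_le (by rw [ZMod.card]; exact h1)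
    refine ⟨fun k s => e.symm (e k + ι s), ?_, ?_⟩
    · intro k s t hst
      simpa using hst
    · intro s
      refine ⟨fun k l hkl => by simpa using hkl, fun k => ⟨e.symm (e k - ι s), by simp⟩⟩

theorem finish {V M F : Type} [Fintype V] [Fintype M] [Field F] [Fintype F] {φ : V → V → M}
    (h : OneFac V M φ) {n g : ℕ} (hV : Fintype.card V = n) (hF : Fintype.card F = g)
    (hM : Fintype.card M = n - 1) (R : Finset M) (hR : R.card = 0 ∨ g ≤ R.card) (a : ℕ)
    (ha : n - 1 = R.card + a * g) (c : V → F)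
    (hc : ∀ x y, x ≠ y → φ x y ∈ R → c x ≠ c y) : IsOF n g := by
  classical
  have hK : Fintype.card {m // m ∈ R} = R.card := by simp
  obtain ⟨w, hw1, hw2⟩ := windows (K := {m // m ∈ R}) (F := F) (by rw [hK, hF]; exact hR)
  have hcomp : Fintype.card {m // ¬ m ∈ R} = a * g := by
    rw [Fintype.card_subtype_compl, hK, hM]
    omega
  have e : (Fin a × F) ≃ {m // ¬ m ∈ R} :=
    Fintype.equivOfCardEq (by rw [hcomp, Fintype.card_prod, Fintype.card_fin, hF])
  obtain ⟨E, hE⟩ := combine h ((Equiv.sumCongr (Equiv.refl _) e).trans (Equiv.sumCompl (· ∈ R)))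
    w hw1 hw2 c (by
      intro x y k hn hk
      apply hc x y hn
      rw [hk]
      simp)
  refine hE.isOF hV hF ?_
  rw [Fintype.card_sum, Fintype.card_prod, hK, hF, ha]
  simp only [Fintype.card_prod, Fintype.card_fin, hF]
  ring

theorem zmod_two {m : ℕ} (hm : Odd m) : ∃ h : ZMod m, 2 * h = 1 := by
  have h2 : IsUnit ((2 : ℕ) : ZMod m) := by
    rw [ZMod.isUnit_iff_coprime]
    exact (Nat.coprime_two_left.mpr hm)
  obtain ⟨h, hh⟩ := h2.exists_right_inv
  exact ⟨h, by simpa using hh⟩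

/-- The standard one-factorization. -/
def facInf (m : ℕ) : Option (ZMod m) → Option (ZMod m) → ZMod m
  | some x, some y => x + y
  | some x, none => 2 * x
  | none, some y => 2 * y
  | none, none => 0

theorem facInf_oneFac {m : ℕ} (hm : Odd m) : OneFac _ _ (facInf m) := by
  obtain ⟨h, hh⟩ := zmod_two hm
  have hc : ∀ x y : ZMod m, 2 * x = 2 * y → x = y := by
    intro x y e
    linear_combination (y - x) * hh + h * e
  refine ⟨?_, ?_, ?_⟩
  · rintro (_ | x) (_ | y) <;> simp [facInf, add_comm]
  · rintro (_ | x) d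
    · exact ⟨some (h * d), by simp, by simp only [facInf]; linear_combination d * hh⟩
    · by_cases hx : x = d - x
      · exact ⟨none, by simp, by simp only [facInf]; linear_combination hx⟩
      · exact ⟨some (d - x), by simpa using hx, by simp [facInf]⟩
  · rintro (_ | x) (_ | y) (_ | z) h1 h2 e <;> simp only [facInf] at e
    · rfl
    · exact absurd rfl h1
    · exact absurd rfl h2
    · rw [hc _ _ e]
    · rfl
    · exact absurd (by rw [show x = z by linear_combination e]) h2
    · exact absurd (by rw [show x = y by linear_combination -e]) h1
    · rw [add_left_cancel e]

/-- Doubling of a one-factorization. -/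
def facEven {W N : Type} {u : ℕ} (e : W ≃ ZMod u) (ψ : W → W → N) :
    W × Bool → W × Bool → N ⊕ ZMod u
  | (x, false), (y, false) => Sum.inl (ψ x y)
  | (x, true), (y, true) => Sum.inl (ψ x y)
  | (x, false), (y, true) => Sum.inr (e y - e x)
  | (x, true), (y, false) => Sum.inr (e x - e y)

theorem facEven_oneFac {W N : Type} {u : ℕ} (e : W ≃ ZMod u) (ψ : W → W → N)
    (h : OneFac W N ψ) : OneFac _ _ (facEven e ψ) := by
  refine ⟨?_, ?_, ?_⟩
  · rintro ⟨x, _ | _⟩ ⟨y, _ | _⟩ <;> simp only [facEven]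
    · rw [h.symm]
    · rw [h.symm]
  · rintro ⟨x, _ | _⟩ (m | m)
    · obtain ⟨y, h1, h2⟩ := h.ex x m
      exact ⟨(y, false), by simpa using h1, by simp [facEven, h2]⟩
    · exact ⟨(e.symm (m + e x), true), by simp, by simp [facEven]⟩
    · obtain ⟨y, h1, h2⟩ := h.ex x m
      exact ⟨(y, true), by simpa using h1, by simp [facEven, h2]⟩
    · exact ⟨(e.symm (e x - m), false), by simp, by simp [facEven]⟩
  · rintro ⟨x, _ | _⟩ ⟨y, _ | _⟩ ⟨z, _ | _⟩ h1 h2 he <;> simp [facEven] at he h1 h2 ⊢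
    · exact h.inj _ _ _ h1 h2 he
    · exact he
    · exact he
    · exact h.inj _ _ _ h1 h2 he

/-- The one-factorization of `K_{2u}` for odd `u`. -/
def facOdd (u : ℕ) : ZMod u × Bool → ZMod u × Bool → ZMod u ⊕ {d : ZMod u // d ≠ 0}
  | (x, false), (y, false) => Sum.inl (x + y)
  | (x, true), (y, true) => Sum.inl (x + y)
  | (x, false), (y, true) => if h : y - x = 0 then Sum.inl (x + y) else Sum.inr ⟨y - x, h⟩
  | (x, true), (y, false) => if h : x - y = 0 then Sum.inl (x + y) else Sum.inr ⟨x - y, h⟩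

theorem facOdd_oneFac {u : ℕ} (hu : Odd u) : OneFac _ _ (facOdd u) := by
  obtain ⟨h, hh⟩ := zmod_two hu
  have hc : ∀ x y : ZMod u, 2 * x = 2 * y → x = y := by
    intro x y e
    linear_combination (y - x) * hh + h * e
  refine ⟨?_, ?_, ?_⟩
  · rintro ⟨x, _ | _⟩ ⟨y, _ | _⟩ <;> simp only [facOdd, add_comm]
  · rintro ⟨x, _ | _⟩ (m | ⟨m, hm⟩)
    · by_cases hx : x = m - x
      · exact ⟨(x, true), by simp, by simp [facOdd]; linear_combination hx⟩
      · exact ⟨(m - x, false), by simpa using hx, by simp [facOdd]⟩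
    · exact ⟨(m + x, true), by simp, by simp [facOdd, hm]⟩
    · by_cases hx : x = m - x
      · exact ⟨(x, false), by simp, by simp [facOdd]; linear_combination hx⟩
      · exact ⟨(m - x, true), by simpa using hx, by simp [facOdd]⟩
    · exact ⟨(x - m, false), by simp, by simp [facOdd, hm]⟩
  · rintro ⟨x, _ | _⟩ ⟨y, _ | _⟩ ⟨z, _ | _⟩ h1 h2 he <;> simp only [facOdd] at he <;>
      (try split_ifs at he with c1 c2) <;> simp at he h1 h2 ⊢
    all_goals first
      | exact he
      | (exfalso; apply h1; linear_combination c1 - he)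
      | (exfalso; apply h1; linear_combination -c1 - he)
      | (exfalso; apply h2; linear_combination c1 + he)
      | (exfalso; apply h2; linear_combination -c1 + he)

theorem prop_even {F : Type} [Field F] [Fintype F] {u g : ℕ} (hu : Even u) (hF : Fintype.card F = g)
    (hg : 2 * g ≤ u) : IsOF (2 * u) g := by
  have hg0 : 0 < g := by rw [← hF]; exact Fintype.card_pos
  have hodd : Odd (u - 1) := Nat.Even.sub_odd (by omega) hu odd_one
  have : NeZero (u - 1) := ⟨by omega⟩
  have : NeZero u := ⟨by omega⟩
  have e : Option (ZMod (u - 1)) ≃ ZMod u := Fintype.equivOfCardEq (by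
    rw [Fintype.card_option, ZMod.card, ZMod.card]; omega)
  have h := facEven_oneFac e _ (facInf_oneFac hodd)
  have hr : g + (2 * u - 1) % g ≤ (Finset.univ : Finset (ZMod u)).card := by
    rw [Finset.card_univ, ZMod.card]
    have := Nat.mod_lt (2 * u - 1) hg0
    omega
  obtain ⟨T, -, hT⟩ := Finset.exists_subset_card_eq hr
  have hd := Nat.div_add_mod (2 * u - 1) g
  have hq : 1 ≤ (2 * u - 1) / g := by
    rw [Nat.le_div_iff_mul_le hg0]; omega
  obtain ⟨q, hq'⟩ : ∃ q, (2 * u - 1) / g = q + 1 := ⟨_, (Nat.sub_add_cancel hq).symm⟩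
  refine finish h (n := 2 * u) (g := g) ?_ hF ?_ (T.map ⟨Sum.inr, Sum.inr_injective⟩) ?_ q ?_
    (fun p => if p.2 then 1 else 0) ?_
  · simp only [Fintype.card_prod, Fintype.card_option, ZMod.card, Fintype.card_bool]; omega
  · simp only [Fintype.card_sum, ZMod.card]; omega
  · right; rw [Finset.card_map, hT]; omega
  · rw [Finset.card_map, hT]
    rw [hq'] at hd
    linarith
  · rintro ⟨x, _ | _⟩ ⟨y, _ | _⟩ hn hm <;> simp [facEven] at hm ⊢

theorem prop_odd_big {F : Type} [Field F] [Fintype F] {u g : ℕ} (hu : Odd u)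
    (hF : Fintype.card F = g) (hg : 3 * g ≤ 2 * u - 1) (hgo : Odd g) : IsOF (2 * u) g := by
  have hg0 : 0 < g := by rw [← hF]; exact Fintype.card_pos
  have : NeZero u := ⟨by omega⟩
  have h := facOdd_oneFac hu
  have hcd : Fintype.card {d : ZMod u // d ≠ 0} = u - 1 := by
    rw [Fintype.card_subtype_compl]; simp [ZMod.card]
  have hr : g + (2 * u - 1) % g ≤ (Finset.univ : Finset {d : ZMod u // d ≠ 0}).card := by
    rw [Finset.card_univ, hcd]
    have := Nat.mod_lt (2 * u - 1) hg0
    by_cases h2 : 2 * g ≤ u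
    · omega
    · have : (2 * u - 1) % g = 2 * u - 1 - 3 * g := by
        rw [← Nat.mod_eq_of_lt (show 2 * u - 1 - 3 * g < g by omega)]
        conv_lhs => rw [show 2 * u - 1 = (2 * u - 1 - 3 * g) + g * 3 by omega]
        rw [Nat.add_mul_mod_self_left]
      omega
  obtain ⟨T, -, hT⟩ := Finset.exists_subset_card_eq hr
  have hd := Nat.div_add_mod (2 * u - 1) g
  have hq : 1 ≤ (2 * u - 1) / g := by
    rw [Nat.le_div_iff_mul_le hg0]; omega
  obtain ⟨q, hq'⟩ : ∃ q, (2 * u - 1) / g = q + 1 := ⟨_, (Nat.sub_add_cancel hq).symm⟩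
  refine finish h (n := 2 * u) (g := g) ?_ hF ?_ (T.map ⟨Sum.inr, Sum.inr_injective⟩) ?_ q ?_
    (fun p => if p.2 then 1 else 0) ?_
  · simp only [Fintype.card_prod, ZMod.card, Fintype.card_bool]; omega
  · rw [Fintype.card_sum, hcd, ZMod.card]; omega
  · right; rw [Finset.card_map, hT]; omega
  · rw [Finset.card_map, hT]
    rw [hq'] at hd
    linarith
  · rintro ⟨x, _ | _⟩ ⟨y, _ | _⟩ hn hm <;> simp [facOdd] at hm ⊢

/-- The explicit colouring of the sum graph on `ℤ_u`. -/
def colr (g h v : ℕ) : ℕ :=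
  if v = 0 then 1 else if v < h then 1 + v else if 2 * v < g + 2 * h then 0
  else if 2 * (g + 2 * h - v) ≤ g + 1 then 1 else 2 + ((g + 2 * h - v) - (g + 3) / 2)

theorem colr_le (g h v : ℕ) (hg : g % 2 = 1) (hv : v < g + 2 * h) (hh : 1 ≤ h)
    (hgh : 4 * h + 1 ≤ g) : colr g h v < h + 1 := by
  unfold colr
  split_ifs <;> omega

theorem colr_ne (g h v v' : ℕ) (hg : g % 2 = 1) (hv : v < g + 2 * h) (hv' : v' < g + 2 * h)
    (hh : 1 ≤ h) (hgh : 4 * h + 1 ≤ g) (hne : v ≠ v')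
    (hs : v + v' < 2 * h ∨ (g + 2 * h ≤ v + v' ∧ v + v' < g + 4 * h)) :
    colr g h v ≠ colr g h v' := by
  unfold colr
  split_ifs <;> omega

theorem prop_odd_small {F : Type} [Field F] [Fintype F] {u g : ℕ} (hu : Odd u)
    (hF : Fintype.card F = g) (hgo : Odd g) (hgu : g < u) (hg : 2 * u - 1 < 3 * g) :
    IsOF (2 * u) g := by
  have hg0 : 0 < g := by rw [← hF]; exact Fintype.card_pos
  have : NeZero u := ⟨by omega⟩
  have h := facOdd_oneFac hu
  have hcd : Fintype.card {d : ZMod u // d ≠ 0} = u - 1 := by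
    rw [Fintype.card_subtype_compl]; simp [ZMod.card]
  rw [Nat.odd_iff] at hu hgo
  obtain ⟨k, hk⟩ : ∃ k, u = g + 2 * k := ⟨(u - g) / 2, by omega⟩
  have hk1 : 1 ≤ k := by omega
  have hk2 : 4 * k + 1 ≤ g := by omega
  let T : Finset (ZMod u) := Finset.univ.filter (fun x => x.val < 2 * k)
  have hT : T.card = 2 * k := by
    have : T = (Finset.range (2 * k)).image (fun i : ℕ => (i : ZMod u)) := by
      ext x
      simp only [T, Finset.mem_filter, Finset.mem_univ, true_and, Finset.mem_image,
        Finset.mem_range]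
      constructor
      · intro hx; exact ⟨x.val, hx, by simp⟩
      · rintro ⟨i, hi, rfl⟩
        rw [ZMod.val_natCast, Nat.mod_eq_of_lt (by omega)]; exact hi
    rw [this, Finset.card_image_of_injOn, Finset.card_range]
    intro i hi j hj hij
    simp only [Finset.coe_range, Set.mem_Iio] at hi hj
    have := congrArg ZMod.val hij
    simp only [ZMod.val_natCast] at this
    rwa [Nat.mod_eq_of_lt (by omega), Nat.mod_eq_of_lt (by omega)] at this
  have ef : Fin g ≃ F := (Fintype.equivFinOfCardEq hF).symm
  have hcl : ∀ x : ZMod u, colr g k x.val < k + 1 := fun x =>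
    colr_le g k x.val hgo (by rw [← hk]; exact ZMod.val_lt x) hk1 hk2
  have hcn : ∀ x y : ZMod u, x ≠ y → x + y ∈ T → colr g k x.val ≠ colr g k y.val := by
    intro x y hxy hT
    have hx := ZMod.val_lt x
    have hy := ZMod.val_lt y
    refine colr_ne g k x.val y.val hgo (by omega) (by omega) hk1 hk2
      (fun e => hxy (ZMod.val_injective u e)) ?_
    simp only [T, Finset.mem_filter, Finset.mem_univ, true_and] at hT
    rw [ZMod.val_add] at hT
    by_cases hlt : x.val + y.val < u
    · rw [Nat.mod_eq_of_lt hlt] at hT; left; exact hT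
    · rw [Nat.mod_eq_sub_mod (by omega), Nat.mod_eq_of_lt (by omega)] at hT
      right; omega
  have hcb : ∀ p : ZMod u × Bool, colr g k p.1.val + (if p.2 then k + 1 else 0) < g := by
    intro p
    have := hcl p.1
    split_ifs <;> omega
  refine finish h (n := 2 * u) (g := g) ?_ hF ?_ (T.disjSum Finset.univ) ?_ 1 ?_
    (fun p => ef ⟨colr g k p.1.val + (if p.2 then k + 1 else 0), hcb p⟩) ?_
  · simp only [Fintype.card_prod, ZMod.card, Fintype.card_bool]; omega
  · rw [Fintype.card_sum, hcd, ZMod.card]; omega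
  · right; rw [Finset.card_disjSum, hT, Finset.card_univ, hcd]; omega
  · rw [Finset.card_disjSum, hT, Finset.card_univ, hcd]; omega
  · rintro ⟨x, e⟩ ⟨y, f⟩ hn hm he
    have he' := congrArg Fin.val (ef.injective he)
    have hx := hcl x
    have hy := hcl y
    rcases e with _ | _ <;> rcases f with _ | _ <;> simp only [facOdd] at hm <;> simp at he'
    · exact hcn x y (fun e => hn (by rw [e])) (by simpa using hm) he'
    · omega
    · omega
    · exact hcn x y (fun e => hn (by rw [e])) (by simpa using hm) he'

theorem prop_twice {F : Type} [Field F] [Fintype F] {g : ℕ} (hF : Fintype.card F = g)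
    (hgo : Odd g) : IsOF (2 * g) g := by
  classical
  have h2 : (2 : F) ≠ 0 := by
    apply Ring.two_ne_zero
    intro h
    have := FiniteField.even_card_of_char_two h
    rw [hF] at this
    rw [Nat.odd_iff] at hgo
    omega
  have hg0 : 0 < g := by rw [← hF]; exact Fintype.card_pos
  obtain ⟨E, hE⟩ := twice h2
  refine hE.isOF ?_ hF ?_
  · simp [hF, mul_comm]
  · have hcd : Fintype.card {d : F // d ≠ 0} = g - 1 := by
      rw [Fintype.card_subtype_compl]; simp [hF]
    rw [Fintype.card_sum, Fintype.card_prod, Fintype.card_prod, hcd, hF, ← mul_add]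
    congr 1; omega

theorem prop_succ {F : Type} [Field F] [Fintype F] {g : ℕ} (hF : Fintype.card F = g)
    (hgo : Odd g) : IsOF (g + 1) g := by
  have hg0 : 0 < g := by rw [← hF]; exact Fintype.card_pos
  have : NeZero g := ⟨by omega⟩
  refine finish (facInf_oneFac hgo) (n := g + 1) (g := g) ?_ hF ?_ ∅ ?_ 1 ?_ (fun _ => 0) ?_
  · rw [Fintype.card_option, ZMod.card]
  · rw [ZMod.card]; rfl
  · left; rfl
  · simp
  · simp

/-- Let `g ≥ 3` be an odd prime power and let `n > g` be even such that neither
(`n ≡ 2 (mod 4)` and `g+3 ≤ n ≤ 2g-4`) nor (`n ≡ 0 (mod 4)` and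
`g+3 ≤ n ≤ 4g-4`) holds. Then an `OF(n,g)` exists. -/
theorem exists_OF_odd_prime_pow_g (n g : ℕ) (hg3 : 3 ≤ g) (hgo : Odd g)
    (hgpp : IsPrimePow g) (hng : g < n) (hne : Even n)
    (h1 : ¬(n % 4 = 2 ∧ g + 3 ≤ n ∧ n ≤ 2 * g - 4))
    (h2 : ¬(n % 4 = 0 ∧ g + 3 ≤ n ∧ n ≤ 4 * g - 4)) : IsOF n g := by
  obtain ⟨p, k, hp, hk, hpk⟩ := hgpp
  have hp' : Fact p.Prime := ⟨hp.nat_prime⟩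
  let F := GaloisField p k
  have hfin : Fintype F := Fintype.ofFinite F
  have hF : Fintype.card F = g := by
    rw [← Nat.card_eq_fintype_card, GaloisField.card p k hk.ne', hpk]
  obtain ⟨u, hu⟩ := hne
  have hgo' := Nat.odd_iff.mp hgo
  have hn : n = 2 * u := by omega
  by_cases c1 : n = g + 1
  · rw [c1]; exact prop_succ hF hgo
  by_cases c2 : n = 2 * g
  · rw [c2]; exact prop_twice hF hgo
  rcases Nat.even_or_odd u with he | ho
  · have he' := Nat.even_iff.mp he
    rw [hn]
    exact prop_even he hF (by omega)
  · have ho' := Nat.odd_iff.mp ho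
    rw [hn]
    by_cases c3 : 3 * g ≤ 2 * u - 1
    · exact prop_odd_big ho hF c3 hgo
    · exact prop_odd_small ho hF hgo (by omega) (by omega)
end
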